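/- arXiv:math/0409233 — 5 statements merged into one kernel-verified Lean document; each statement's English description precedes it below -/
import Mathlib

section
/- Let A = (a b; c d) ∈ GL₂(ℤ) with d ≥ 1. Then there is one and only one choice of an integer s ≥ 1 and integers a₀, a₁, …, a_s with a₁, …, a_{s−1} ≥ 1 such that A = (a₀ 1; 1 0)·(a₁ 1; 1 0)·⋯·(a_s 1; 1 0). Moreover, these integers are also characterized by the three properties b/d = [a₀, …, a_{s−1}], c/d = [a_s, …, a₁], and det A = (−1)^{s+1}. -/
open Matrix

/-- 2×2 integer matrices. -/
abbrev M2 : Type := Matrix (Fin 2) (Fin 2) ℤ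

/-- The content of an integer matrix: the gcd of its coefficients. -/
def content (A : M2) : ℕ :=
  Nat.gcd (Nat.gcd (A 0 0).natAbs (A 0 1).natAbs) (Nat.gcd (A 1 0).natAbs (A 1 1).natAbs)

/-- A matrix is primitive if its content is 1. -/
def Primitive (A : M2) : Prop := content A = 1

/-- Membership in 𝒫: primitive with nonzero determinant. -/
def MemP (A : M2) : Prop := Primitive A ∧ A.det ≠ 0

/-- `A^red`: the primitive matrix such that `A = content A • A^red`. -/
def red (A : M2) : M2 := Matrix.of fun i j => A i j / (content A : ℤ)

/-- The group operation of 𝒫: `A * B = (AB)^red`. -/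
def pmul (A B : M2) : M2 := red (A * B)

/-- A Fibonacci sequence in 𝒫 (indices from 1). -/
def IsFibP (W : ℕ → M2) : Prop :=
  (∀ i, 1 ≤ i → MemP (W i)) ∧ ∀ i, 1 ≤ i → W (i + 2) = pmul (W (i + 1)) (W i)

/-- Admissibility of a Fibonacci sequence in 𝒫: there is a non-symmetric,
non-skew-symmetric N ∈ 𝒫 such that W_i N_i is symmetric for all i ≥ 1,
where N_i = ᵗN for odd i and N_i = N for even i. -/
def AdmissibleFib (W : ℕ → M2) : Prop :=
  ∃ N : M2, MemP N ∧ N ≠ Nᵀ ∧ N ≠ -Nᵀ ∧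
    ∀ i, 1 ≤ i → (W i * (if i % 2 = 1 then Nᵀ else N)).IsSymm

/-- The norm of an integer 2×2 matrix: max absolute value of coefficients, as a real. -/
noncomputable def mnorm (A : M2) : ℝ :=
  max (max |(A 0 0 : ℝ)| |(A 0 1 : ℝ)|) (max |(A 1 0 : ℝ)| |(A 1 1 : ℝ)|)

/-- The sequence is unbounded in norm. -/
def UnboundedSeq (W : ℕ → M2) : Prop := ∀ C : ℝ, ∃ i, 1 ≤ i ∧ C < mnorm (W i)

/-- The golden ratio γ = (1+√5)/2. -/
noncomputable def gam : ℝ := (1 + Real.sqrt 5) / 2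

/-- Norm of the row vector (ξ, -1)·A. -/
noncomputable def xiNorm (ξ : ℝ) (A : M2) : ℝ :=
  max |ξ * (A 0 0 : ℝ) - (A 1 0 : ℝ)| |ξ * (A 0 1 : ℝ) - (A 1 1 : ℝ)|

/-- ξ is extremal: neither rational nor quadratic over ℚ, and for each X ≥ 1 the system
|x₀| ≤ X, |x₀ξ - x₁| ≤ c X^(-1/γ), |x₀ξ² - x₂| ≤ c X^(-1/γ) has a nonzero integer solution. -/
def IsExtremal (ξ : ℝ) : Prop :=
  (∀ a b c : ℚ, ¬(a = 0 ∧ b = 0 ∧ c = 0) → (a : ℝ) * ξ ^ 2 + (b : ℝ) * ξ + (c : ℝ) ≠ 0) ∧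
  ∃ c : ℝ, 0 < c ∧ ∀ X : ℝ, 1 ≤ X → ∃ x₀ x₁ x₂ : ℤ,
    ¬(x₀ = 0 ∧ x₁ = 0 ∧ x₂ = 0) ∧ |(x₀ : ℝ)| ≤ X ∧
    |(x₀ : ℝ) * ξ - (x₁ : ℝ)| ≤ c * X ^ (-1 / gam) ∧
    |(x₀ : ℝ) * ξ ^ 2 - (x₂ : ℝ)| ≤ c * X ^ (-1 / gam)

/-- The Fibonacci sequence `W` in 𝒫 is associated to the extremal real number ξ:
it is an unbounded admissible Fibonacci sequence in 𝒫 with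
‖W_{i+1}‖ ≍ ‖W_i‖^γ, ‖(ξ,-1)W_i‖ ≍ ‖W_i‖⁻¹ and |det W_i| ≍ 1. -/
def IsAssociated (ξ : ℝ) (W : ℕ → M2) : Prop :=
  IsFibP W ∧ UnboundedSeq W ∧ AdmissibleFib W ∧
  ∃ c₁ c₂ c₃ c₄ c₅ c₆ : ℝ, 0 < c₁ ∧ 0 < c₂ ∧ 0 < c₃ ∧ 0 < c₄ ∧ 0 < c₅ ∧ 0 < c₆ ∧
    ∀ i, 1 ≤ i →
      c₁ * mnorm (W i) ^ gam ≤ mnorm (W (i + 1)) ∧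
      mnorm (W (i + 1)) ≤ c₂ * mnorm (W i) ^ gam ∧
      c₃ * (mnorm (W i))⁻¹ ≤ xiNorm ξ (W i) ∧
      xiNorm ξ (W i) ≤ c₄ * (mnorm (W i))⁻¹ ∧
      c₅ ≤ |((W i).det : ℝ)| ∧ |((W i).det : ℝ)| ≤ c₆

/-- Membership in GL₂(ℤ): integer matrix of determinant ±1. -/
def InGL2Z (A : M2) : Prop := A.det = 1 ∨ A.det = -1

/-- ξ is badly approximable: irrational and |ξ - p/q| > c/q² for all rationals p/q. -/
def BadlyApprox (ξ : ℝ) : Prop :=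
  Irrational ξ ∧ ∃ c : ℝ, 0 < c ∧ ∀ p q : ℤ, q ≠ 0 → c / (q : ℝ) ^ 2 < |ξ - (p : ℝ) / (q : ℝ)|

/-- Partial quotients of the continued fraction expansion: `cfA n ξ` is `aₙ`
where ξ = [a₀, a₁, a₂, …]. -/
noncomputable def cfA : ℕ → ℝ → ℤ
  | 0, ξ => ⌊ξ⌋
  | n + 1, ξ => cfA n (ξ - ⌊ξ⌋)⁻¹

/-- A Fibonacci sequence of words (indices from 1). -/
def FibWordSeq {α : Type} (w : ℕ → List α) : Prop := ∀ i, 1 ≤ i → w (i + 2) = w (i + 1) ++ w i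

/-- `b` (indexed from 1: the limit word is b₁b₂b₃…) is the infinite limit word of the
sequence of words `w`: every `w k` (k ≥ 2) is a prefix of it, and their lengths are unbounded. -/
def IsLimitWord {α : Type} (w : ℕ → List α) (b : ℕ → α) : Prop :=
  (∀ n : ℕ, ∃ k, 2 ≤ k ∧ n ≤ (w k).length) ∧
  ∀ k, 2 ≤ k → ∀ j, (h : j < (w k).length) → (w k).get ⟨j, h⟩ = b (j + 1)

/-- The Fibonacci sequence of words over the alphabet E = {a, b} (with `b = false`,
`a = true`): w₁ = b, w₂ = a, w_{k+2} = w_{k+1} w_k.  Its limit is f_{a,b}. -/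
def fw : ℕ → List Bool
  | 0 => []
  | 1 => [false]
  | 2 => [true]
  | n + 3 => fw (n + 2) ++ fw (n + 1)

/-- The prefix of length `i` of the infinite Fibonacci word `f_{a,b}`
(note `fw (i+2)` is a prefix of `f_{a,b}` of length ≥ i). -/
def fpref (i : ℕ) : List Bool := (fw (i + 2)).take i

/-- The monoid morphism Φ : E* → (𝒫, *) with Φ(b) = W₁, Φ(a) = W₂
(the letter `b` is `false` and `a` is `true`). -/
def PhiW (W1 W2 : M2) : List Bool → M2
  | [] => 1
  | x :: u => pmul (if x then W2 else W1) (PhiW W1 W2 u)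

/-- The set 𝒮₁ of real matrices (a b; c d) with a ≥ max{b,c} and min{b,c} ≥ d ≥ 0. -/
def S1 : Set (Matrix (Fin 2) (Fin 2) ℝ) :=
  {A | max (A 0 1) (A 1 0) ≤ A 0 0 ∧ A 1 1 ≤ min (A 0 1) (A 1 0) ∧ 0 ≤ A 1 1}

/-- The set 𝒮 = 𝒮₁ ∩ GL₂(ℤ), viewed as a set of integer matrices. -/
def Sset : Set M2 :=
  {A | (A.map (Int.cast : ℤ → ℝ)) ∈ S1 ∧ (A.det = 1 ∨ A.det = -1)}

/-- ξ is an extremal real number with an associated Fibonacci sequence in GL₂(ℤ). -/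
def HasGLAssoc (ξ : ℝ) : Prop :=
  IsExtremal ξ ∧ ∃ W : ℕ → M2, IsAssociated ξ W ∧ ∀ i, 1 ≤ i → InGL2Z (W i)

/-- ξ is an extremal real number with an associated Fibonacci sequence in 𝒮. -/
def HasSAssoc (ξ : ℝ) : Prop :=
  IsExtremal ξ ∧ ∃ W : ℕ → M2, IsAssociated ξ W ∧ ∀ i, 1 ≤ i → W i ∈ Sset

/-- Value of a finite continued fraction [a₀, a₁, …, aₙ] = a₀ + 1/(a₁ + 1/(⋯ + 1/aₙ))
as a rational number. -/
def cfVal : List ℤ → ℚ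
  | [] => 0
  | a :: l => (a : ℚ) + (cfVal l)⁻¹

/-- The product of the matrices `(t 1; 1 0)` for `t` in the list `m`. -/
def cfMat (m : List ℤ) : M2 := (m.map (fun t : ℤ => !![t, 1; 1, 0])).prod

lemma cfMat_nil : cfMat [] = 1 := rfl

lemma cfMat_cons (x : ℤ) (m : List ℤ) : cfMat (x :: m) = !![x, 1; 1, 0] * cfMat m := by
  simp [cfMat]

lemma cfMat_append (m n : List ℤ) : cfMat (m ++ n) = cfMat m * cfMat n := by
  simp [cfMat]

lemma cfMat_singleton (x : ℤ) : cfMat [x] = !![x, 1; 1, 0] := by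
  simp [cfMat]

lemma cfMat_cons_apply (x : ℤ) (m : List ℤ) :
    cfMat (x :: m) 0 0 = x * cfMat m 0 0 + cfMat m 1 0 ∧
    cfMat (x :: m) 0 1 = x * cfMat m 0 1 + cfMat m 1 1 ∧
    cfMat (x :: m) 1 0 = cfMat m 0 0 ∧ cfMat (x :: m) 1 1 = cfMat m 0 1 := by
  simp [cfMat_cons, Matrix.mul_apply, Fin.sum_univ_two]

lemma cfMat_concat_apply (m : List ℤ) (z : ℤ) :
    cfMat (m ++ [z]) 0 0 = cfMat m 0 0 * z + cfMat m 0 1 ∧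
    cfMat (m ++ [z]) 0 1 = cfMat m 0 0 ∧
    cfMat (m ++ [z]) 1 0 = cfMat m 1 0 * z + cfMat m 1 1 ∧
    cfMat (m ++ [z]) 1 1 = cfMat m 1 0 := by
  simp [cfMat_append, cfMat_singleton, Matrix.mul_apply, Fin.sum_univ_two]

lemma cfMat_det (m : List ℤ) : (cfMat m).det = (-1) ^ m.length := by
  induction m with
  | nil => simp [cfMat_nil]
  | cons x m ih => rw [cfMat_cons, Matrix.det_mul, ih]; simp [Matrix.det_fin_two, pow_succ]

lemma cfMat_reverse (m : List ℤ) : cfMat m.reverse = (cfMat m)ᵀ := by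
  induction m with
  | nil => simp [cfMat_nil]
  | cons x m ih =>
    rw [List.reverse_cons, cfMat_append, ih, cfMat_cons x m, Matrix.transpose_mul,
      cfMat_singleton]
    congr 1
    ext i j
    fin_cases i <;> fin_cases j <;> rfl

lemma cfMat_bounds (m : List ℤ) (hm : ∀ x ∈ m, 1 ≤ x) :
    1 ≤ cfMat m 0 0 ∧ 0 ≤ cfMat m 1 0 ∧ cfMat m 1 0 ≤ cfMat m 0 0 ∧
    (cfMat m 1 0 = 0 → m = []) ∧ (cfMat m 1 0 = cfMat m 0 0 → m = [1]) := by
  induction m with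
  | nil => simp [cfMat_nil]
  | cons y m ih =>
    obtain ⟨h1, h2, h3, h4, h5⟩ := ih fun x hx => hm x (List.mem_cons_of_mem _ hx)
    have hy : 1 ≤ y := hm y List.mem_cons_self
    obtain ⟨e1, -, e3, -⟩ := cfMat_cons_apply y m
    rw [e1, e3]
    refine ⟨by nlinarith, by lia, by nlinarith, by lia, fun h => ?_⟩
    have hr : cfMat m 1 0 = 0 := by nlinarith
    have hy1 : y = 1 := by nlinarith
    rw [h4 hr, hy1]

lemma cfVal_cons (x : ℤ) (m : List ℤ) (hm : ∀ x ∈ m, 1 ≤ x) :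
    cfVal (x :: m) = (x : ℚ) + (cfMat m 1 0 : ℚ) / (cfMat m 0 0 : ℚ) := by
  induction m generalizing x with
  | nil => simp [cfVal, cfMat_nil]
  | cons y m ih =>
    have hm' : ∀ x ∈ m, 1 ≤ x := fun x hx => hm x (List.mem_cons_of_mem _ hx)
    have h1 : (cfMat m 0 0 : ℚ) ≠ 0 := by
      have := (cfMat_bounds m hm').1
      exact_mod_cast (by lia : cfMat m 0 0 ≠ 0)
    obtain ⟨e1, -, e3, -⟩ := cfMat_cons_apply y m
    rw [cfVal, ih y hm', e1, e3]
    push_cast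
    rw [← inv_div]
    congr 2
    field_simp

lemma cfMat_cons_concat_apply (x z : ℤ) (m : List ℤ) :
    cfMat (x :: (m ++ [z])) 0 1 = x * cfMat m 0 0 + cfMat m 1 0 ∧
    cfMat (x :: (m ++ [z])) 1 0 = z * cfMat m 0 0 + cfMat m 0 1 ∧
    cfMat (x :: (m ++ [z])) 1 1 = cfMat m 0 0 := by
  obtain ⟨-, e2, e3, e4⟩ := cfMat_cons_apply x (m ++ [z])
  obtain ⟨f1, f2, f3, f4⟩ := cfMat_concat_apply m z
  rw [e2, e3, e4, f1, f2, f4]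
  exact ⟨rfl, by ring, rfl⟩

lemma cfMat_injective (m : List ℤ) (hm : ∀ x ∈ m, 1 ≤ x) :
    ∀ (x z x' z' : ℤ) (m' : List ℤ), (∀ x ∈ m', 1 ≤ x) →
      cfMat (x :: (m ++ [z])) = cfMat (x' :: (m' ++ [z'])) →
      x = x' ∧ m = m' ∧ z = z' := by
  induction m with
  | nil =>
    intro x z x' z' m' hm' h
    obtain ⟨a1, a2, a3⟩ := cfMat_cons_concat_apply x z []
    obtain ⟨b1, b2, b3⟩ := cfMat_cons_concat_apply x' z' m'
    rw [h] at a1 a2 a3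
    obtain ⟨c1, c2, c3, c4, c5⟩ := cfMat_bounds m' hm'
    simp only [cfMat_nil, Matrix.one_apply_eq, ne_eq, one_ne_zero, zero_ne_one,
      not_false_eq_true, Matrix.one_apply_ne] at a1 a2 a3
    have hd := cfMat_det ([x] ++ [z])
    have hd' := cfMat_det (x' :: (m' ++ [z']))
    have hp : cfMat m' 0 0 = 1 := by lia
    by_cases hr : cfMat m' 1 0 = 0
    · obtain rfl := c4 hr
      simp only [cfMat_nil, Matrix.one_apply_eq, ne_eq, one_ne_zero, zero_ne_one,
        not_false_eq_true, Matrix.one_apply_ne] at b1 b2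
      exact ⟨by lia, rfl, by lia⟩
    · obtain rfl := c5 (by lia)
      rw [← h] at hd'
      simp at hd hd'
      lia
  | cons y m ih =>
    have hm0 : ∀ x ∈ m, 1 ≤ x := fun x hx => hm x (List.mem_cons_of_mem _ hx)
    intro x z x' z' m' hm' h
    obtain ⟨a1, a2, a3⟩ := cfMat_cons_concat_apply x z (y :: m)
    obtain ⟨b1, b2, b3⟩ := cfMat_cons_concat_apply x' z' m'
    rw [h] at a1 a2 a3
    obtain ⟨c1, c2, c3, c4, c5⟩ := cfMat_bounds m' hm'
    obtain ⟨d1, d2, d3, d4, d5⟩ := cfMat_bounds (y :: m) hm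
    have hd := congrArg Matrix.det h
    rw [cfMat_det, cfMat_det] at hd
    have hr0 : cfMat (y :: m) 1 0 ≠ 0 := fun h => by simpa using d4 h
    have hxx : x = x' := by
      by_contra hne
      have hp : cfMat m' 0 0 = cfMat (y :: m) 0 0 := by lia
      rw [hp] at b1 c1 c3 c5
      have hle : x' = x + 1 := by
        rcases lt_or_gt_of_ne hne with hlt | hlt
        · nlinarith
        · exfalso
          nlinarith [(by lia : 0 < cfMat (y :: m) 1 0)]
      subst hle
      have hr : cfMat m' 1 0 = 0 := by lia
      have hr' : cfMat (y :: m) 1 0 = cfMat (y :: m) 0 0 := by lia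
      rw [c4 hr, d5 hr'] at hd
      simp at hd
    subst hxx
    have hp : cfMat m' 0 0 = cfMat (y :: m) 0 0 := by lia
    rw [hp] at b1
    have hr : cfMat m' 1 0 = cfMat (y :: m) 1 0 := by lia
    cases m' with
    | nil => simp [cfMat_nil] at hr; lia
    | cons y' m' =>
      have h' : cfMat (y :: (m ++ [z])) = cfMat (y' :: (m' ++ [z'])) := by
        rw [cfMat_cons x, cfMat_cons x] at h
        have hu : IsUnit (!![x, 1; 1, 0] : M2) := by
          rw [Matrix.isUnit_iff_isUnit_det]; simp [Matrix.det_fin_two]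
        exact hu.mul_left_cancel h
      obtain ⟨rfl, rfl, rfl⟩ := ih hm0 y z y' z' m'
        (fun x hx => hm' x (List.mem_cons_of_mem _ hx)) h'
      simp

lemma M2_ext_of_det {A B : M2} (hd : A 1 1 ≠ 0) (h01 : A 0 1 = B 0 1) (h10 : A 1 0 = B 1 0)
    (h11 : A 1 1 = B 1 1) (hdet : A.det = B.det) : A = B := by
  rw [Matrix.det_fin_two, Matrix.det_fin_two, ← h01, ← h10, ← h11] at hdet
  have h00 : A 0 0 = B 0 0 := mul_right_cancel₀ hd (by linarith)
  ext i j
  fin_cases i <;> fin_cases j <;> assumption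

lemma exists_cfMat_eq (n : ℕ) : ∀ A : M2, (A.det = 1 ∨ A.det = -1) → 1 ≤ A 1 1 → A 1 1 ≤ n →
    ∃ (x z : ℤ) (m : List ℤ), (∀ x ∈ m, 1 ≤ x) ∧ A = cfMat (x :: (m ++ [z])) := by
  induction n with
  | zero => intro A _ h1 h2; push_cast at h2; lia
  | succ n ih =>
    intro A hA h1 h2
    rcases eq_or_lt_of_le h1 with hd | hd
    · rcases hA with hA | hA
      · refine ⟨A 0 1, A 1 0, [], by simp, ?_⟩
        obtain ⟨b1, b2, b3⟩ := cfMat_cons_concat_apply (A 0 1) (A 1 0) []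
        simp only [cfMat_nil, Matrix.one_apply_eq, ne_eq, one_ne_zero, zero_ne_one,
          not_false_eq_true, Matrix.one_apply_ne] at b1 b2 b3
        refine M2_ext_of_det (by lia) (by lia) (by lia) (by lia) ?_
        rw [cfMat_det, hA]; simp
      · refine ⟨A 0 1 - 1, A 1 0 - 1, [1], by simp, ?_⟩
        obtain ⟨b1, b2, b3⟩ := cfMat_cons_concat_apply (A 0 1 - 1) (A 1 0 - 1) [1]
        simp [cfMat_singleton] at b1 b2 b3
        refine M2_ext_of_det (by lia) (by simp [b1]) (by simp [b2]) (by simp [b3, ← hd]) ?_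
        rw [cfMat_det, hA]; simp
    · set x := A 0 1 / A 1 1 with hx
      have hh := Int.emod_add_mul_ediv (A 0 1) (A 1 1)
      have hlt := Int.emod_lt_of_pos (A 0 1) (by lia : 0 < A 1 1)
      have hge := Int.emod_nonneg (A 0 1) (by lia : A 1 1 ≠ 0)
      rw [← hx] at hh
      set h := A 0 1 % A 1 1
      have hpos : 1 ≤ h := by
        by_contra hc
        have h0 : h = 0 := by lia
        rw [h0, zero_add] at hh
        rw [Matrix.det_fin_two, ← hh] at hA
        have hdvd : A 1 1 ∣ 1 := by
          rcases hA with hA | hA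
          · exact ⟨A 0 0 - x * A 1 0, by linarith⟩
          · exact ⟨-(A 0 0 - x * A 1 0), by linarith⟩
        have := Int.le_of_dvd one_pos hdvd
        lia
      have hQ : A = !![x, 1; 1, 0] * !![A 1 0, A 1 1; A 0 0 - x * A 1 0, h] := by
        ext i j
        fin_cases i <;> fin_cases j <;> simp [Matrix.mul_apply, Fin.sum_univ_two]
        linarith
      have hdet : (!![A 1 0, A 1 1; A 0 0 - x * A 1 0, h] : M2).det = 1 ∨
          (!![A 1 0, A 1 1; A 0 0 - x * A 1 0, h] : M2).det = -1 := by
        have h3 : A.det = -(!![A 1 0, A 1 1; A 0 0 - x * A 1 0, h] : M2).det := by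
          conv_lhs => rw [hQ, Matrix.det_mul]
          simp [Matrix.det_fin_two]
        rw [h3] at hA
        lia
      obtain ⟨y, z, m, hm, hQm⟩ := ih _ hdet (by simpa using hpos)
        (by simp; push_cast at h2; lia)
      refine ⟨x, z, y :: m, ?_, ?_⟩
      · obtain ⟨b1, b2, b3⟩ := cfMat_cons_concat_apply y z m
        obtain ⟨c1, c2, c3, c4, c5⟩ := cfMat_bounds m hm
        rw [← hQm] at b1 b3
        simp at b1 b3
        have hy : 1 ≤ y := by
          by_contra hc
          nlinarith
        simpa [hy] using hm
      · rw [List.cons_append, cfMat_cons, ← hQm]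
        exact hQ

lemma exists_eq_cons_concat {L : List ℤ} (hL : 2 ≤ L.length) :
    ∃ (x z : ℤ) (m : List ℤ), L = x :: (m ++ [z]) := by
  match L, hL with
  | x :: y :: l, _ =>
    exact ⟨x, (y :: l).getLast (by simp), (y :: l).dropLast, by
      rw [List.dropLast_append_getLast]⟩

lemma isCoprime_of_det {A : M2} (hA : A.det = 1 ∨ A.det = -1) : IsCoprime (A 0 1) (A 1 1) := by
  rw [Matrix.det_fin_two] at hA
  rcases hA with hA | hA
  · exact ⟨-A 1 0, A 0 0, by linarith⟩
  · exact ⟨A 1 0, -A 0 0, by linarith⟩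

lemma eq_and_eq_of_div_eq_div {a b c d : ℤ} (hb : 0 < b) (hd : 0 < d) (hab : IsCoprime a b)
    (hcd : IsCoprime c d) (h : (a : ℚ) / b = c / d) : a = c ∧ b = d :=
  Rat.div_int_inj hb hd (Int.isCoprime_iff_gcd_eq_one.1 hab) (Int.isCoprime_iff_gcd_eq_one.1 hcd) h

lemma eq_cfMat_iff {A : M2} (hA : A.det = 1 ∨ A.det = -1) (hd : 1 ≤ A 1 1) (x z : ℤ)
    (m : List ℤ) (hm : ∀ x ∈ m, 1 ≤ x) :
    A = cfMat (x :: (m ++ [z])) ↔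
      ((A 0 1 : ℚ) / (A 1 1 : ℚ) = cfVal (x :: m) ∧
       (A 1 0 : ℚ) / (A 1 1 : ℚ) = cfVal (z :: m.reverse) ∧
       A.det = (-1) ^ (x :: (m ++ [z])).length) := by
  obtain ⟨b1, b2, b3⟩ := cfMat_cons_concat_apply x z m
  have hp := (cfMat_bounds m hm).1
  have hp0 : (cfMat m 0 0 : ℚ) ≠ 0 := by exact_mod_cast (by lia : cfMat m 0 0 ≠ 0)
  rw [cfVal_cons x m hm, cfVal_cons z m.reverse (by simpa using hm), cfMat_reverse]
  simp only [Matrix.transpose_apply]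
  constructor
  · intro h
    rw [← h] at b1 b2 b3
    refine ⟨?_, ?_, by rw [← cfMat_det, ← h]⟩
    · rw [b1, b3]; push_cast; field_simp
    · rw [b2, b3]; push_cast; field_simp
  · rintro ⟨h1, h2, h3⟩
    have hB : (cfMat (x :: (m ++ [z]))).det = 1 ∨ (cfMat (x :: (m ++ [z]))).det = -1 := by
      rwa [cfMat_det, ← h3]
    obtain ⟨e1, e2⟩ := eq_and_eq_of_div_eq_div (by lia) (by lia) (isCoprime_of_det hA)
      (isCoprime_of_det hB) (by rw [h1, b1, b3]; push_cast; field_simp)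
    refine M2_ext_of_det (by lia) e1 ?_ e2 (by rw [cfMat_det, h3])
    rw [e2, b3, div_eq_iff hp0, add_mul, div_mul_cancel₀ _ hp0] at h2
    rw [b2]
    exact_mod_cast h2

/-- Any A = (a b; c d) ∈ GL₂(ℤ) with d ≥ 1 has a unique factorization
A = (a₀ 1; 1 0)⋯(a_s 1; 1 0) with s ≥ 1 and a₁, …, a_{s-1} ≥ 1 (a list L = [a₀, …, a_s]);
moreover such a factorization holds iff b/d = [a₀,…,a_{s-1}], c/d = [a_s,…,a₁] and
det A = (-1)^{s+1}. -/
theorem stmt8 (A : M2) (hA : A.det = 1 ∨ A.det = -1) (hd : 1 ≤ A 1 1) :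
    (∃! L : List ℤ, 2 ≤ L.length ∧ (∀ x ∈ (L.drop 1).dropLast, 1 ≤ x) ∧
      A = (L.map (fun t : ℤ => !![t, 1; 1, 0])).prod) ∧
    (∀ L : List ℤ, 2 ≤ L.length → (∀ x ∈ (L.drop 1).dropLast, 1 ≤ x) →
      (A = (L.map (fun t : ℤ => !![t, 1; 1, 0])).prod ↔
        ((A 0 1 : ℚ) / (A 1 1 : ℚ) = cfVal L.dropLast ∧
         (A 1 0 : ℚ) / (A 1 1 : ℚ) = cfVal (L.drop 1).reverse ∧
         A.det = (-1) ^ L.length))) := by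
  have hmid : ∀ (x z : ℤ) (m : List ℤ), ((x :: (m ++ [z])).drop 1).dropLast = m := by simp
  constructor
  · obtain ⟨x, z, m, hm, hAm⟩ := exists_cfMat_eq (A 1 1).toNat A hA hd (by lia)
    refine ⟨x :: (m ++ [z]), ⟨by simp, by rwa [hmid], hAm⟩, ?_⟩
    rintro L ⟨hL, hLm, hAL⟩
    obtain ⟨x', z', m', rfl⟩ := exists_eq_cons_concat hL
    rw [hmid] at hLm
    obtain ⟨rfl, rfl, rfl⟩ := cfMat_injective m hm x z x' z' m' hLm (hAm.symm.trans hAL)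
    rfl
  · intro L hL hLm
    obtain ⟨x, z, m, rfl⟩ := exists_eq_cons_concat hL
    rw [hmid] at hLm
    have h1 : (x :: (m ++ [z])).dropLast = x :: m := by
      rw [← List.cons_append, List.dropLast_concat]
    have h2 : ((x :: (m ++ [z])).drop 1).reverse = z :: m.reverse := by simp
    rw [h1, h2]
    exact eq_cfMat_iff hA hd x z m hLm
end

section
/- The sets 𝒮₁ and 𝒮 are closed under matrix multiplication and under transposition. Moreover, the map from the positive integers to 𝒮 sending each positive integer a to the matrix (a 1; 1 0) extends to an isomorphism of monoids σ from the free monoid of words over the positive integers onto 𝒮 ∪ {I}, where I is the 2×2 identity matrix. -/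
open Matrix

/-- The map sending a word over the positive integers to the corresponding product of
matrices (a 1; 1 0). -/
def sigmaW (w : List ℕ+) : M2 := (w.map (fun t : ℕ+ => !![(t : ℤ), 1; 1, 0])).prod

theorem mem_S1_iff (A : Matrix (Fin 2) (Fin 2) ℝ) :
    A ∈ S1 ↔ A 0 1 ≤ A 0 0 ∧ A 1 0 ≤ A 0 0 ∧ A 1 1 ≤ A 0 1 ∧ A 1 1 ≤ A 1 0 ∧ 0 ≤ A 1 1 := by
  simp only [S1, Set.mem_ofPred_eq, max_le_iff, le_min_iff, and_assoc]

theorem mem_Sset_iff (A : M2) :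
    A ∈ Sset ↔ (A 0 1 ≤ A 0 0 ∧ A 1 0 ≤ A 0 0 ∧ A 1 1 ≤ A 0 1 ∧ A 1 1 ≤ A 1 0 ∧ 0 ≤ A 1 1) ∧
      (A 0 0 * A 1 1 - A 0 1 * A 1 0 = 1 ∨ A 0 0 * A 1 1 - A 0 1 * A 1 0 = -1) := by
  simp only [Sset, Set.mem_ofPred_eq, mem_S1_iff, Matrix.map_apply, Matrix.det_fin_two,
    Int.cast_le, Int.cast_nonneg_iff]

theorem S1_mul_mem {A B : Matrix (Fin 2) (Fin 2) ℝ} (hA : A ∈ S1) (hB : B ∈ S1) :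
    A * B ∈ S1 := by
  rw [mem_S1_iff] at hA hB ⊢
  obtain ⟨h1, h2, h3, h4, h5⟩ := hA
  obtain ⟨k1, k2, k3, k4, k5⟩ := hB
  simp only [Matrix.mul_apply, Fin.sum_univ_two]
  refine ⟨?_, ?_, ?_, ?_, ?_⟩
  · gcongr <;> linarith
  · gcongr <;> linarith
  · gcongr; linarith
  · gcongr; linarith
  · have := mul_nonneg (h5.trans h4) (k5.trans k3)
    have := mul_nonneg h5 k5
    linarith

theorem S1_transpose_mem {A : Matrix (Fin 2) (Fin 2) ℝ} (hA : A ∈ S1) : Aᵀ ∈ S1 := by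
  rw [mem_S1_iff] at hA ⊢
  simp only [Matrix.transpose_apply]
  tauto

theorem Sset_mul_mem {A B : M2} (hA : A ∈ Sset) (hB : B ∈ Sset) : A * B ∈ Sset := by
  refine ⟨?_, ?_⟩
  · rw [show (A * B).map (Int.cast : ℤ → ℝ) = A.map Int.cast * B.map Int.cast from
      Matrix.map_mul (f := Int.castRingHom ℝ)]
    exact S1_mul_mem hA.1 hB.1
  · rw [Matrix.det_mul]
    rcases hA.2 with h | h <;> rcases hB.2 with k | k <;> simp [h, k]

theorem Sset_transpose_mem {A : M2} (hA : A ∈ Sset) : Aᵀ ∈ Sset := by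
  refine ⟨?_, ?_⟩
  · exact S1_transpose_mem hA.1
  · rw [Matrix.det_transpose]
    exact hA.2

theorem one_notMem_Sset : (1 : M2) ∉ Sset := by
  simp [mem_Sset_iff]

theorem letter_mem_Sset (a : ℕ+) : (!![(a : ℤ), 1; 1, 0] : M2) ∈ Sset := by
  have : (1 : ℤ) ≤ a := by exact_mod_cast a.pos
  simp [mem_Sset_iff, this]

theorem sigmaW_nil : sigmaW [] = 1 := rfl

theorem sigmaW_cons (a : ℕ+) (w : List ℕ+) :
    sigmaW (a :: w) = !![(a : ℤ), 1; 1, 0] * sigmaW w := by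
  simp [sigmaW]

theorem sigmaW_append (w₁ w₂ : List ℕ+) : sigmaW (w₁ ++ w₂) = sigmaW w₁ * sigmaW w₂ := by
  simp [sigmaW]

theorem sigmaW_singleton (a : ℕ+) : sigmaW [a] = !![(a : ℤ), 1; 1, 0] := by
  simp [sigmaW]

theorem sigmaW_mem (w : List ℕ+) : sigmaW w ∈ Sset ∪ {(1 : M2)} := by
  induction w with
  | nil => exact Or.inr rfl
  | cons a w ih =>
    left
    rw [sigmaW_cons]
    rcases ih with h | h
    · exact Sset_mul_mem (letter_mem_Sset a) h
    · rw [Set.mem_singleton_iff.1 h, mul_one]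
      exact letter_mem_Sset a

theorem sigmaW_cons_mem (a : ℕ+) (w : List ℕ+) : sigmaW (a :: w) ∈ Sset := by
  rw [sigmaW_cons]
  rcases sigmaW_mem w with h | h
  · exact Sset_mul_mem (letter_mem_Sset a) h
  · rw [Set.mem_singleton_iff.1 h, mul_one]
    exact letter_mem_Sset a

/-- A matrix of `𝒮 ∪ {I}` either has positive off-diagonal entries or is `I`. -/
theorem entries_of_mem {M : M2} (h : M ∈ Sset ∪ {(1 : M2)}) :
    (0 < M 0 1 ∧ 0 < M 1 0 ∧ M 1 0 ≤ M 0 0 ∧ M 1 1 ≤ M 0 1 ∧ 0 ≤ M 1 1) ∨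
      (M 0 0 = 1 ∧ M 0 1 = 0 ∧ M 1 0 = 0 ∧ M 1 1 = 1) := by
  rcases h with h | h
  · left
    obtain ⟨⟨h1, h2, h3, h4, h5⟩, hdet⟩ := (mem_Sset_iff M).1 h
    have hb : M 0 1 ≠ 0 := by
      intro hb
      have hd : M 1 1 = 0 := by omega
      simp [hb, hd] at hdet
    have hc : M 1 0 ≠ 0 := by
      intro hc
      have hd : M 1 1 = 0 := by omega
      simp [hc, hd] at hdet
    omega
  · right
    rw [Set.mem_singleton_iff.1 h]
    simp

theorem letter_le_of_mul_eq {a b : ℕ+} {M N : M2} (hM : M ∈ Sset ∪ {(1 : M2)})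
    (hN : N ∈ Sset ∪ {(1 : M2)})
    (h : (!![(a : ℤ), 1; 1, 0] : M2) * M = !![(b : ℤ), 1; 1, 0] * N) : (a : ℤ) ≤ b := by
  have e00 := congrFun (congrFun h 0) 0
  have e01 := congrFun (congrFun h 0) 1
  have e10 := congrFun (congrFun h 1) 0
  have e11 := congrFun (congrFun h 1) 1
  simp [Matrix.mul_apply, Fin.sum_univ_two] at e00 e01 e10 e11
  rw [← e10] at e00
  rw [← e11] at e01
  by_contra! hab
  rcases entries_of_mem hM with hM | hM <;> rcases entries_of_mem hN with hN | hN
  · nlinarith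
  · omega
  · omega
  · simp only [hM, hN] at e00
    omega

theorem letter_mul_left_cancel {a : ℤ} {M N : M2}
    (h : (!![a, 1; 1, 0] : M2) * M = !![a, 1; 1, 0] * N) : M = N := by
  have h' := congrArg ((!![0, 1; 1, -a] : M2) * ·) h
  have hinv : (!![0, 1; 1, -a] : M2) * !![a, 1; 1, 0] = 1 := by
    simp [Matrix.one_fin_two]
  simpa only [← mul_assoc, hinv, one_mul] using h'

theorem sigmaW_injective : Function.Injective sigmaW := by
  intro w
  induction w with
  | nil =>
    rintro (_ | ⟨b, v⟩) h
    · rfl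
    · refine absurd ?_ one_notMem_Sset
      rw [← sigmaW_nil, h]
      exact sigmaW_cons_mem b v
  | cons a w ih =>
    rintro (_ | ⟨b, v⟩) h
    · refine absurd ?_ one_notMem_Sset
      rw [← sigmaW_nil, ← h]
      exact sigmaW_cons_mem a w
    · rw [sigmaW_cons, sigmaW_cons] at h
      have hab : a = b := by
        exact_mod_cast le_antisymm (letter_le_of_mul_eq (sigmaW_mem w) (sigmaW_mem v) h)
          (letter_le_of_mul_eq (sigmaW_mem v) (sigmaW_mem w) h.symm)
      subst hab
      rw [ih (letter_mul_left_cancel h)]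

/-- One step of the Euclidean algorithm on a matrix of `𝒮` with non-zero last entry. -/
theorem exists_letter_mul {A : M2} (hA : A ∈ Sset) (hd : A 1 1 ≠ 0) :
    ∃ (q : ℕ+) (B : M2), B ∈ Sset ∧ A = !![(q : ℤ), 1; 1, 0] * B ∧
      B 1 0 + B 1 1 < A 1 0 + A 1 1 := by
  obtain ⟨⟨h1, h2, h3, h4, h5⟩, hdet⟩ := (mem_Sset_iff A).1 hA
  obtain ⟨a, b, c, d, rfl⟩ : ∃ a b c d : ℤ, A = !![a, b; c, d] :=
    ⟨_, _, _, _, Matrix.eta_fin_two A⟩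
  simp at h1 h2 h3 h4 h5 hdet hd
  suffices ∃ q : ℤ, 1 ≤ q ∧ a - q * c ≤ c ∧ b - q * d ≤ a - q * c ∧ b - q * d ≤ d ∧
      0 ≤ b - q * d ∧ (a - q * c) + (b - q * d) < c + d by
    obtain ⟨q, hq, hqc, hqr, hqd, hq0, hlt⟩ := this
    lift q to ℕ using by omega
    refine ⟨⟨q, by omega⟩, !![c, d; a - q * c, b - q * d], ?_, ?_, by simpa using hlt⟩
    · rw [mem_Sset_iff]
      simp only [of_apply, cons_val_zero, cons_val_one, cons_val', cons_val_fin_one]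
      refine ⟨⟨h4, hqc, hqd, hqr, hq0⟩, ?_⟩
      rcases hdet with h | h
      · right; linear_combination -h
      · left; linear_combination -h
    · ext i j
      fin_cases i <;> fin_cases j <;> simp
  have hd1 : 1 ≤ d := by omega
  obtain ⟨q, r, rfl, hr0, hrd⟩ : ∃ q r : ℤ, b = q * d + r ∧ 0 ≤ r ∧ r < d :=
    ⟨b / d, b % d, by rw [mul_comm, Int.mul_ediv_add_emod], Int.emod_nonneg _ hd,
      Int.emod_lt_of_pos _ (by omega)⟩
  have hq : 1 ≤ q := by
    by_contra! hq
    nlinarith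
  obtain ⟨e, rfl⟩ : ∃ e, a = q * c + e := ⟨a - q * c, by ring⟩
  have hed : e * d - r * c = 1 ∨ e * d - r * c = -1 := by
    rcases hdet with h | h
    · left; linear_combination h
    · right; linear_combination h
  have hec : e ≤ c := by
    by_contra! hec
    rcases hed with h | h <;> nlinarith
  by_cases hre : r ≤ e
  · refine ⟨q, hq, ?_⟩
    simp only [add_sub_cancel_left]
    omega
  · obtain rfl : d = 1 := by
      by_contra hd2
      have : 2 ≤ d := by omega
      rcases hed with h | h <;> nlinarith
    obtain rfl : r = 0 := by omega
    obtain rfl : e = -1 := by omega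
    have hq2 : 2 ≤ q := by
      by_contra! hq2
      obtain rfl : q = 1 := by omega
      omega
    have hc2 : 2 ≤ c := by
      by_contra! hc2
      obtain rfl : c = 1 := by omega
      omega
    refine ⟨q - 1, by omega, ?_⟩
    ring_nf
    omega

theorem mem_range_sigmaW_of_mem_Sset {A : M2} (hA : A ∈ Sset) : A ∈ Set.range sigmaW := by
  induction hn : (A 1 0 + A 1 1).toNat using Nat.strong_induction_on generalizing A with
  | _ n ih =>
    obtain ⟨⟨h1, h2, h3, h4, h5⟩, hdet⟩ := (mem_Sset_iff A).1 hA
    by_cases hd : A 1 1 = 0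
    · have hbc : A 0 1 * A 1 0 = 1 := by
        have := mul_nonneg (h5.trans h3) (h5.trans h4)
        rw [hd] at hdet
        omega
      have hb : A 0 1 = 1 := Int.eq_one_of_mul_eq_one_right (h5.trans h3) hbc
      have hc : A 1 0 = 1 := by rwa [hb, one_mul] at hbc
      obtain ⟨k, hk⟩ := Int.eq_ofNat_of_zero_le (show 0 ≤ A 0 0 by omega)
      lift k to ℕ+ using by omega
      refine ⟨[k], ?_⟩
      rw [sigmaW_singleton, Matrix.eta_fin_two A, hb, hc, hd, hk]
    · obtain ⟨q, B, hB, rfl, hlt⟩ := exists_letter_mul hA hd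
      obtain ⟨w, rfl⟩ := ih _ (by omega) hB rfl
      exact ⟨q :: w, sigmaW_cons q w⟩

theorem range_sigmaW : Set.range sigmaW = Sset ∪ {(1 : M2)} := by
  refine Set.Subset.antisymm (Set.range_subset_iff.2 sigmaW_mem) ?_
  rintro A (hA | rfl)
  · exact mem_range_sigmaW_of_mem_Sset hA
  · exact ⟨[], sigmaW_nil⟩

/-- 𝒮₁ and 𝒮 are closed under multiplication and transposition, and σ is an isomorphism of
monoids from the free monoid of words over the positive integers onto 𝒮 ∪ {I}. -/
theorem stmt9 :
    (∀ A B : Matrix (Fin 2) (Fin 2) ℝ, A ∈ S1 → B ∈ S1 → A * B ∈ S1) ∧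
    (∀ A : Matrix (Fin 2) (Fin 2) ℝ, A ∈ S1 → Aᵀ ∈ S1) ∧
    (∀ A B : M2, A ∈ Sset → B ∈ Sset → A * B ∈ Sset) ∧
    (∀ A : M2, A ∈ Sset → Aᵀ ∈ Sset) ∧
    (∀ a : ℕ+, sigmaW [a] = !![(a : ℤ), 1; 1, 0]) ∧
    (∀ w₁ w₂ : List ℕ+, sigmaW (w₁ ++ w₂) = sigmaW w₁ * sigmaW w₂) ∧
    Function.Injective sigmaW ∧
    Set.range sigmaW = Sset ∪ {(1 : M2)} := by
  exact ⟨fun _ _ => S1_mul_mem, fun _ => S1_transpose_mem, fun _ _ => Sset_mul_mem,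
    fun _ => Sset_transpose_mem, sigmaW_singleton, sigmaW_append, sigmaW_injective, range_sigmaW⟩
end

section
/- (i) If ξ is an extremal real number having an associated Fibonacci sequence all of whose terms lie in GL₂(ℤ), and if (a b; c d) ∈ GL₂(ℤ), then the real number (aξ+b)/(cξ+d) is also an extremal real number having an associated Fibonacci sequence all of whose terms lie in GL₂(ℤ). (ii) For every extremal real number ξ having an associated Fibonacci sequence in GL₂(ℤ), there exists a matrix (a b; c d) ∈ GL₂(ℤ) such that (aξ+b)/(cξ+d) is an extremal real number having an associated Fibonacci sequence all of whose terms lie in 𝒮. -/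
open Matrix

theorem gam_pos : 0 < gam := by unfold gam; positivity

theorem one_lt_gam : 1 < gam := by
  unfold gam
  have : (1 : ℝ) < Real.sqrt 5 := by
    rw [Real.lt_sqrt] <;> norm_num
  linarith

theorem gam_mul_gam_sub_one : gam * (gam - 1) = 1 := by
  unfold gam
  have : Real.sqrt 5 * Real.sqrt 5 = 5 := Real.mul_self_sqrt (by norm_num)
  linarith [this, show (1 + Real.sqrt 5) / 2 * ((1 + Real.sqrt 5) / 2 - 1)
    = (Real.sqrt 5 * Real.sqrt 5 - 1) / 4 by ring]

theorem abs_le_mnorm (A : M2) (i j : Fin 2) : |(A i j : ℝ)| ≤ mnorm A := by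
  fin_cases i <;> fin_cases j <;> simp [mnorm]

theorem mnorm_le_iff {A : M2} {C : ℝ} : mnorm A ≤ C ↔ ∀ i j, |(A i j : ℝ)| ≤ C := by
  simp [mnorm, Fin.forall_fin_two]

theorem one_le_mnorm {A : M2} (h : InGL2Z A) : 1 ≤ mnorm A := by
  by_contra! hlt
  have h0 : ∀ i j, A i j = 0 := fun i j => by
    have h1 := (abs_le_mnorm A i j).trans_lt hlt
    rw [← Int.cast_abs] at h1
    exact Int.abs_lt_one_iff.mp (by exact_mod_cast h1)
  have : A.det = 0 := by simp [det_fin_two, h0]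
  rcases h with h | h <;> omega

theorem abs_mul_add_mul_le {a b c d A B : ℝ} (ha : |a| ≤ A) (hb : |b| ≤ A) (hc : |c| ≤ B)
    (hd : |d| ≤ B) : |a * c + b * d| ≤ 2 * A * B := by
  have h1 : |a * c| ≤ A * B := by
    rw [abs_mul]; exact mul_le_mul ha hc (abs_nonneg _) ((abs_nonneg _).trans ha)
  have h2 : |b * d| ≤ A * B := by
    rw [abs_mul]; exact mul_le_mul hb hd (abs_nonneg _) ((abs_nonneg _).trans hb)
  linarith [abs_add_le (a * c) (b * d)]

theorem mnorm_mul_le (A B : M2) : mnorm (A * B) ≤ 2 * mnorm A * mnorm B := by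
  rw [mnorm_le_iff]
  intro i j
  rw [mul_apply, Fin.sum_univ_two]
  push_cast
  exact abs_mul_add_mul_le (abs_le_mnorm _ _ _) (abs_le_mnorm _ _ _) (abs_le_mnorm _ _ _)
    (abs_le_mnorm _ _ _)

theorem xiNorm_mul_le (ξ : ℝ) (A B : M2) : xiNorm ξ (A * B) ≤ 2 * xiNorm ξ A * mnorm B := by
  have key : ∀ j, |ξ * ((A * B) 0 j : ℝ) - ((A * B) 1 j : ℝ)| ≤ 2 * xiNorm ξ A * mnorm B := by
    intro j
    have := abs_mul_add_mul_le (le_max_left |ξ * (A 0 0 : ℝ) - (A 1 0 : ℝ)| _)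
      (le_max_right _ |ξ * (A 0 1 : ℝ) - (A 1 1 : ℝ)|) (abs_le_mnorm B 0 j) (abs_le_mnorm B 1 j)
    refine le_of_eq_of_le ?_ this
    congr 1
    simp only [mul_apply, Fin.sum_univ_two]
    push_cast
    ring
  exact max_le (key 0) (key 1)

theorem mnorm_sign_smul {s : ℤ} (hs : s = 1 ∨ s = -1) (A : M2) : mnorm (s • A) = mnorm A := by
  rcases hs with rfl | rfl <;> simp [mnorm]

theorem xiNorm_sign_smul {s : ℤ} (hs : s = 1 ∨ s = -1) (ξ : ℝ) (A : M2) :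
    xiNorm ξ (s • A) = xiNorm ξ A := by
  rcases hs with rfl | rfl
  · simp
  · unfold xiNorm
    congr 1 <;> rw [← abs_neg] <;> congr 1 <;> simp <;> ring

theorem inGL2Z_iff_isUnit_det {A : M2} : InGL2Z A ↔ IsUnit A.det := Int.isUnit_iff.symm

theorem InGL2Z.mul {A B : M2} (hA : InGL2Z A) (hB : InGL2Z B) : InGL2Z (A * B) := by
  rw [inGL2Z_iff_isUnit_det] at *
  rw [det_mul]
  exact hA.mul hB

theorem InGL2Z.sign_smul {s : ℤ} (hs : s = 1 ∨ s = -1) {A : M2} (hA : InGL2Z A) :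
    InGL2Z (s • A) := by
  rcases hs with rfl | rfl
  · simpa using hA
  · simpa [InGL2Z, det_fin_two] using hA

theorem inGL2Z_of_mul_eq_one {A B : M2} (h : A * B = 1) : InGL2Z A :=
  inGL2Z_iff_isUnit_det.mpr (isUnit_det_of_right_inverse h)

theorem primitive_iff {A : M2} : Primitive A ↔ ∀ d : ℕ, (∀ i j, (d : ℤ) ∣ A i j) → d = 1 := by
  have hdvd : ∀ d : ℕ, d ∣ content A ↔ ∀ i j, (d : ℤ) ∣ A i j := fun d => by
    simp [content, Nat.dvd_gcd_iff, Fin.forall_fin_two, Int.natCast_dvd]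
  constructor
  · intro h d hd
    have := (hdvd d).mpr hd
    rw [h] at this
    exact Nat.dvd_one.mp this
  · intro h
    exact h _ ((hdvd _).mp dvd_rfl)

theorem dvd_mul_entries {d : ℤ} {A : M2} (h : ∀ i j, d ∣ A i j) (B C : M2) (i j : Fin 2) :
    d ∣ (B * A * C) i j := by
  simp only [mul_apply]
  exact Finset.dvd_sum fun k _ =>
    (Finset.dvd_sum fun l _ => (h _ _).mul_left _).mul_right _

theorem InGL2Z.primitive {A : M2} (h : InGL2Z A) : Primitive A := by
  rw [primitive_iff]
  intro d hd
  have h1 : (d : ℤ) ∣ A.det := by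
    rw [det_fin_two]
    exact dvd_sub ((hd _ _).mul_right _) ((hd _ _).mul_right _)
  have h2 := isUnit_of_dvd_unit h1 (inGL2Z_iff_isUnit_det.mp h)
  simpa using Int.isUnit_iff_natAbs_eq.mp h2

theorem InGL2Z.memP {A : M2} (h : InGL2Z A) : MemP A :=
  ⟨h.primitive, (inGL2Z_iff_isUnit_det.mp h).ne_zero⟩

theorem InGL2Z.pmul_eq {A B : M2} (hA : InGL2Z A) (hB : InGL2Z B) : pmul A B = A * B := by
  have h : content (A * B) = 1 := (hA.mul hB).primitive
  ext i j
  simp [pmul, red, h]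

theorem InGL2Z.abs_det {A : M2} (h : InGL2Z A) : |(A.det : ℝ)| = 1 := by
  rcases h with h | h <;> simp [h]

/-- Congruence by an invertible integer matrix preserves primitivity and regularity. -/
theorem MemP.congr {N M Mi : M2} (hN : MemP N) (h : M * Mi = 1) : MemP (Mi * N * Miᵀ) := by
  have hback : M * (Mi * N * Miᵀ) * Mᵀ = N := by
    calc M * (Mi * N * Miᵀ) * Mᵀ = (M * Mi) * N * (M * Mi)ᵀ := by
          rw [transpose_mul]; simp only [Matrix.mul_assoc]
      _ = N := by simp [h]
  refine ⟨primitive_iff.mpr fun d hd => primitive_iff.mp hN.1 d fun i j => ?_, fun h0 => hN.2 ?_⟩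
  · rw [← hback]
    exact dvd_mul_entries hd _ _ _ _
  · rw [← hback, det_mul, det_mul, h0]
    simp

theorem isSymm_conj_mul_congr {W N M Mi : M2} (h : M * Mi = 1) (hW : (W * N).IsSymm) :
    ((Mi * W * M) * (Mi * N * Miᵀ)).IsSymm := by
  have : (Mi * W * M) * (Mi * N * Miᵀ) = Mi * (W * N) * Miᵀ := by
    calc (Mi * W * M) * (Mi * N * Miᵀ) = Mi * W * (M * Mi) * N * Miᵀ := by
          simp only [Matrix.mul_assoc]
      _ = Mi * (W * N) * Miᵀ := by rw [h, Matrix.mul_one]; simp only [Matrix.mul_assoc]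
  rw [this, IsSymm, transpose_mul, transpose_mul, hW.eq, transpose_transpose]
  simp only [Matrix.mul_assoc]

theorem AdmissibleFib.conj {W : ℕ → M2} (hW : AdmissibleFib W) {M Mi : M2} (h : M * Mi = 1)
    (m : ℕ) (s : ℕ → ℤ) :
    AdmissibleFib (fun i => s i • (Mi * W (i + 2 * m) * M)) := by
  obtain ⟨N, hP, hs, ha, hsym⟩ := hW
  have hback : ∀ X : M2, M * (Mi * X * Miᵀ) * Mᵀ = X := fun X => by
    calc M * (Mi * X * Miᵀ) * Mᵀ = (M * Mi) * X * (M * Mi)ᵀ := by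
          rw [transpose_mul]; simp only [Matrix.mul_assoc]
      _ = X := by simp [h]
  have htr : (Mi * N * Miᵀ)ᵀ = Mi * Nᵀ * Miᵀ := by
    simp only [transpose_mul, transpose_transpose, Matrix.mul_assoc]
  refine ⟨Mi * N * Miᵀ, hP.congr h, fun he => hs ?_, fun he => ha ?_, fun i hi => ?_⟩
  · rw [htr] at he
    exact (hback N).symm.trans (by rw [he, hback])
  · rw [htr] at he
    exact (hback N).symm.trans (by rw [he, Matrix.mul_neg, Matrix.neg_mul, hback])
  · have h1 := hsym (i + 2 * m) (by omega)
    rw [Nat.add_mul_mod_self_left] at h1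
    rw [Matrix.smul_mul]
    refine IsSymm.smul ?_ _
    rw [htr]
    split_ifs with hpar <;> simp only [hpar, if_true, if_false] at h1 <;>
      exact isSymm_conj_mul_congr h h1

theorem IsFibP.eq_mul {W : ℕ → M2} (hW : IsFibP W) (hG : ∀ i, 1 ≤ i → InGL2Z (W i)) {i : ℕ}
    (hi : 1 ≤ i) : W (i + 2) = W (i + 1) * W i := by
  rw [hW.2 i hi, (hG _ (by omega)).pmul_eq (hG _ hi)]

/-- The norms of the terms of an associated sequence tend to infinity. -/
theorem IsAssociated.eventually_le_mnorm {ξ : ℝ} {W : ℕ → M2} (hW : IsAssociated ξ W) (C : ℝ) :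
    ∃ i, 1 ≤ i ∧ ∀ j, i ≤ j → C ≤ mnorm (W j) := by
  obtain ⟨-, hU, -, c₁, c₂, c₃, c₄, c₅, c₆, h₁, -, -, -, -, -, h⟩ := hW
  have hg := one_lt_gam
  set B : ℝ := max (max C 1) (c₁⁻¹ ^ (gam - 1)⁻¹) with hB
  have hB1 : 1 ≤ B := (le_max_right _ _).trans (le_max_left _ _)
  have hBC : C ≤ B := (le_max_left _ _).trans (le_max_left _ _)
  have hBg : 1 ≤ c₁ * B ^ (gam - 1) := by
    have h2 : (c₁⁻¹ ^ (gam - 1)⁻¹) ^ (gam - 1) ≤ B ^ (gam - 1) :=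
      Real.rpow_le_rpow (by positivity) (le_max_right _ _) (by linarith)
    rw [Real.rpow_inv_rpow (by positivity) (by linarith)] at h2
    calc (1 : ℝ) = c₁ * c₁⁻¹ := by field_simp
      _ ≤ _ := by gcongr
  obtain ⟨i, hi, hBi⟩ := hU B
  refine ⟨i, hi, fun j hj => hBC.trans ?_⟩
  induction j, hj using Nat.le_induction with
  | base => exact hBi.le
  | succ j hj ih =>
    refine le_trans ?_ (h j (hi.trans hj)).1
    have hpos : 0 < mnorm (W j) := by linarith
    have h3 : mnorm (W j) ^ gam = mnorm (W j) ^ (gam - 1) * mnorm (W j) := by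
      rw [← Real.rpow_add_one hpos.ne']; congr 1; ring
    rw [h3]
    have h4 : B ^ (gam - 1) ≤ mnorm (W j) ^ (gam - 1) :=
      Real.rpow_le_rpow (by linarith) ih (by linarith)
    calc B ≤ 1 * mnorm (W j) := by linarith
      _ ≤ (c₁ * B ^ (gam - 1)) * mnorm (W j) := by gcongr
      _ ≤ (c₁ * mnorm (W j) ^ (gam - 1)) * mnorm (W j) := by gcongr
      _ = _ := by ring

/-- Conjugating, shifting by an even amount and twisting by a multiplicative choice of signs
preserves association. -/
theorem IsAssociated.conj {ξ ξ' : ℝ} {W : ℕ → M2} (hW : IsAssociated ξ W)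
    (hG : ∀ i, 1 ≤ i → InGL2Z (W i)) {M Mi : M2} (h₁ : M * Mi = 1) (h₂ : Mi * M = 1) {τ : ℝ}
    (hτ : 0 < τ) (hξ : ∀ Y : M2, xiNorm ξ' (Mi * Y) = τ * xiNorm ξ Y) (m : ℕ) {s : ℕ → ℤ}
    (hs : ∀ i, 1 ≤ i → s i = 1 ∨ s i = -1)
    (hss : ∀ i, 1 ≤ i → s (i + 2) = s (i + 1) * s i) :
    IsAssociated ξ' (fun i => s i • (Mi * W (i + 2 * m) * M)) ∧
      ∀ i, 1 ≤ i → InGL2Z (s i • (Mi * W (i + 2 * m) * M)) := by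
  have hGV : ∀ i, 1 ≤ i → InGL2Z (s i • (Mi * W (i + 2 * m) * M)) := fun i hi =>
    (((inGL2Z_of_mul_eq_one h₂).mul (hG _ (by omega))).mul (inGL2Z_of_mul_eq_one h₁)).sign_smul
      (hs i hi)
  have hM : 1 ≤ mnorm M := one_le_mnorm (inGL2Z_of_mul_eq_one h₁)
  have hMi : 1 ≤ mnorm Mi := one_le_mnorm (inGL2Z_of_mul_eq_one h₂)
  have hback : ∀ X : M2, M * (Mi * X * M) * Mi = X := fun X => by
    calc M * (Mi * X * M) * Mi = (M * Mi) * X * (M * Mi) := by simp only [Matrix.mul_assoc]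
      _ = X := by simp [h₁]
  have hpow := hW.eventually_le_mnorm
  obtain ⟨hF, -, hAd, c₁, c₂, c₃, c₄, c₅, c₆, p₁, p₂, p₃, p₄, -, -, h⟩ := hW
  set K : ℝ := 4 * mnorm M * mnorm Mi with hK
  have hK0 : 0 < K := by positivity
  have hle : ∀ i, 1 ≤ i → mnorm (s i • (Mi * W (i + 2 * m) * M)) ≤ K * mnorm (W (i + 2 * m)) := by
    intro i hi
    rw [mnorm_sign_smul (hs i hi)]
    have e₁ := mnorm_mul_le (Mi * W (i + 2 * m)) M
    have e₂ := mnorm_mul_le Mi (W (i + 2 * m))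
    calc _ ≤ _ := e₁
      _ ≤ 2 * (2 * mnorm Mi * mnorm (W (i + 2 * m))) * mnorm M := by gcongr
      _ = _ := by rw [hK]; ring
  have hge : ∀ i, 1 ≤ i → mnorm (W (i + 2 * m)) ≤ K * mnorm (s i • (Mi * W (i + 2 * m) * M)) := by
    intro i hi
    rw [mnorm_sign_smul (hs i hi)]
    have e₁ := mnorm_mul_le (M * (Mi * W (i + 2 * m) * M)) Mi
    have e₂ := mnorm_mul_le M (Mi * W (i + 2 * m) * M)
    rw [hback] at e₁
    calc _ ≤ _ := e₁
      _ ≤ 2 * (2 * mnorm M * mnorm (Mi * W (i + 2 * m) * M)) * mnorm Mi := by gcongr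
      _ = _ := by rw [hK]; ring
  have hxle : ∀ i, 1 ≤ i → xiNorm ξ' (s i • (Mi * W (i + 2 * m) * M)) ≤
      2 * τ * mnorm M * xiNorm ξ (W (i + 2 * m)) := by
    intro i hi
    rw [xiNorm_sign_smul (hs i hi), Matrix.mul_assoc, hξ]
    have := xiNorm_mul_le ξ (W (i + 2 * m)) M
    calc _ ≤ τ * (2 * xiNorm ξ (W (i + 2 * m)) * mnorm M) := by gcongr
      _ = _ := by ring
  have hxge : ∀ i, 1 ≤ i → τ / (2 * mnorm Mi) * xiNorm ξ (W (i + 2 * m)) ≤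
      xiNorm ξ' (s i • (Mi * W (i + 2 * m) * M)) := by
    intro i hi
    rw [xiNorm_sign_smul (hs i hi), Matrix.mul_assoc, hξ]
    have := xiNorm_mul_le ξ (W (i + 2 * m) * M) Mi
    rw [Matrix.mul_assoc, h₁, Matrix.mul_one] at this
    rw [div_mul_eq_mul_div, div_le_iff₀ (by positivity)]
    calc _ ≤ τ * (2 * xiNorm ξ (W (i + 2 * m) * M) * mnorm Mi) := by gcongr
      _ = _ := by ring
  refine ⟨⟨⟨fun i hi => (hGV i hi).memP, fun i hi => ?_⟩, fun C => ?_, hAd.conj h₁ m s,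
    c₁ / (K ^ gam * K), c₂ * K ^ gam * K, τ / (2 * mnorm Mi) * c₃ / K, 2 * τ * mnorm M * c₄ * K,
    1, 1, by positivity, by positivity, by positivity, by positivity, one_pos, one_pos,
    fun i hi => ?_⟩, hGV⟩
  · simp only
    rw [(hGV (i + 1) (by omega)).pmul_eq (hGV i hi), hss i hi, Matrix.smul_mul, Matrix.mul_smul,
      smul_smul]
    congr 1
    rw [show i + 2 + 2 * m = (i + 2 * m) + 2 by ring, hF.eq_mul hG (by omega),
      show i + 1 + 2 * m = i + 2 * m + 1 by ring]
    calc Mi * (W (i + 2 * m + 1) * W (i + 2 * m)) * M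
        = Mi * W (i + 2 * m + 1) * 1 * W (i + 2 * m) * M := by
          rw [Matrix.mul_one]; simp only [Matrix.mul_assoc]
      _ = _ := by rw [← h₁]; simp only [Matrix.mul_assoc]
  · obtain ⟨i, hi, hj⟩ := hpow (K * (C + 1))
    refine ⟨i, hi, ?_⟩
    have := (hj (i + 2 * m) (by omega)).trans (hge i hi)
    linarith [le_of_mul_le_mul_left this hK0]
  · have hi' := h (i + 2 * m) (by omega)
    have q₁ := hle i hi
    have q₂ := hge i hi
    have q₃ := hle (i + 1) (by omega)
    have q₄ := hge (i + 1) (by omega)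
    have q₅ := hxle i hi
    have q₆ := hxge i hi
    have q₇ := one_le_mnorm (hGV i hi)
    have q₈ := one_le_mnorm (hG (i + 2 * m) (by omega))
    have q₉ := (hGV i hi).abs_det
    simp only [show i + 1 + 2 * m = i + 2 * m + 1 by ring] at *
    generalize s i • (Mi * W (i + 2 * m) * M) = V at *
    generalize s (i + 1) • (Mi * W (i + 2 * m + 1) * M) = V' at *
    obtain ⟨r₁, r₂, r₃, r₄, -, -⟩ := hi'
    have hg0 := gam_pos
    have t₁ : mnorm V ^ gam ≤ K ^ gam * mnorm (W (i + 2 * m)) ^ gam := by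
      rw [← Real.mul_rpow hK0.le (by linarith)]
      exact Real.rpow_le_rpow (by linarith) q₁ hg0.le
    have t₂ : mnorm (W (i + 2 * m)) ^ gam ≤ K ^ gam * mnorm V ^ gam := by
      rw [← Real.mul_rpow hK0.le (by linarith)]
      exact Real.rpow_le_rpow (by linarith) q₂ hg0.le
    have u₁ : (mnorm V)⁻¹ ≤ K * (mnorm (W (i + 2 * m)))⁻¹ := by
      rw [← div_eq_mul_inv, inv_eq_one_div, div_le_div_iff₀ (by linarith) (by linarith)]
      linarith
    have u₂ : (mnorm (W (i + 2 * m)))⁻¹ ≤ K * (mnorm V)⁻¹ := by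
      rw [← div_eq_mul_inv, inv_eq_one_div, div_le_div_iff₀ (by linarith) (by linarith)]
      linarith
    refine ⟨?_, ?_, ?_, ?_, q₉.ge, q₉.le⟩
    · calc c₁ / (K ^ gam * K) * mnorm V ^ gam
          ≤ c₁ / (K ^ gam * K) * (K ^ gam * mnorm (W (i + 2 * m)) ^ gam) := by gcongr
        _ = (c₁ * mnorm (W (i + 2 * m)) ^ gam) / K := by field_simp
        _ ≤ mnorm V' := by rw [div_le_iff₀ hK0]; linarith
    · calc mnorm V' ≤ K * mnorm (W (i + 2 * m + 1)) := q₃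
        _ ≤ K * (c₂ * mnorm (W (i + 2 * m)) ^ gam) := by gcongr
        _ ≤ K * (c₂ * (K ^ gam * mnorm V ^ gam)) := by gcongr
        _ = _ := by ring
    · calc τ / (2 * mnorm Mi) * c₃ / K * (mnorm V)⁻¹
          ≤ τ / (2 * mnorm Mi) * c₃ / K * (K * (mnorm (W (i + 2 * m)))⁻¹) := by gcongr
        _ = τ / (2 * mnorm Mi) * (c₃ * (mnorm (W (i + 2 * m)))⁻¹) := by field_simp
        _ ≤ τ / (2 * mnorm Mi) * xiNorm ξ (W (i + 2 * m)) := by gcongr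
        _ ≤ _ := q₆
    · calc xiNorm ξ' V ≤ 2 * τ * mnorm M * xiNorm ξ (W (i + 2 * m)) := q₅
        _ ≤ 2 * τ * mnorm M * (c₄ * (mnorm (W (i + 2 * m)))⁻¹) := by gcongr
        _ ≤ 2 * τ * mnorm M * (c₄ * (K * (mnorm V)⁻¹)) := by gcongr
        _ = _ := by ring

theorem IsExtremal.linear_ne_zero {ξ : ℝ} (h : IsExtremal ξ) {c d : ℤ} (hcd : ¬(c = 0 ∧ d = 0)) :
    (c : ℝ) * ξ + d ≠ 0 := by
  have := h.1 0 c d (by simpa using hcd)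
  simpa using this

theorem InGL2Z.row_ne_zero {A : M2} (hA : InGL2Z A) : ¬(A 1 0 = 0 ∧ A 1 1 = 0) := by
  rintro ⟨h0, h1⟩
  apply (inGL2Z_iff_isUnit_det.mp hA).ne_zero
  simp [det_fin_two, h0, h1]

theorem IsExtremal.mobius {ξ : ℝ} (h : IsExtremal ξ) {A : M2} (hA : InGL2Z A) :
    IsExtremal (((A 0 0 : ℝ) * ξ + (A 0 1 : ℝ)) / ((A 1 0 : ℝ) * ξ + (A 1 1 : ℝ))) := by
  have hD := h.linear_ne_zero hA.row_ne_zero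
  have hdet : (A 0 0 * A 1 1 - A 0 1 * A 1 0) ^ 2 = 1 := by
    rw [← det_fin_two]
    rcases hA with h | h <;> simp [h]
  obtain ⟨hq, k, hk, happ⟩ := h
  generalize A 0 0 = a at *
  generalize A 0 1 = b at *
  generalize A 1 0 = c at *
  generalize A 1 1 = d at *
  set η : ℝ := ((a : ℝ) * ξ + b) / ((c : ℝ) * ξ + d) with hη
  have hηD : η * ((c : ℝ) * ξ + d) = a * ξ + b := div_mul_cancel₀ _ hD
  have hdetq : ((a : ℚ) * d - b * c) ^ 2 = 1 := by exact_mod_cast hdet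
  refine ⟨fun p q r hpqr h0 => ?_, ?_⟩
  · refine hq (p * a ^ 2 + q * a * c + r * c ^ 2) (2 * p * a * b + q * (a * d + b * c) +
      2 * r * c * d) (p * b ^ 2 + q * b * d + r * d ^ 2) ?_ ?_
    · rintro ⟨e₁, e₂, e₃⟩
      refine hpqr ⟨?_, ?_, ?_⟩
      · linear_combination d ^ 2 * e₁ - c * d * e₂ + c ^ 2 * e₃ - p * hdetq
      · linear_combination -2 * b * d * e₁ + (a * d + b * c) * e₂ - 2 * a * c * e₃ - q * hdetq
      · linear_combination b ^ 2 * e₁ - a * b * e₂ + a ^ 2 * e₃ - r * hdetq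
    · push_cast
      linear_combination ((c : ℝ) * ξ + d) ^ 2 * h0 - (p * (η * (c * ξ + d) + a * ξ + b) +
        q * (c * ξ + d)) * hηD
  · set k₁ : ℝ := ((c : ℝ) * ξ + d) ^ 2 + (|2 * (c : ℝ) * d| + |(c : ℝ) ^ 2|) * k + 1 with hk₁
    set k₂ : ℝ := |(a : ℝ) * d + b * c - 2 * c * d * η| + |(a : ℝ) * c - c ^ 2 * η| +
      |2 * (a : ℝ) * b - 2 * c * d * η ^ 2| + |(a : ℝ) ^ 2 - c ^ 2 * η ^ 2| + 1 with hk₂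
    have hk₁1 : 1 ≤ k₁ := by
      have : 0 ≤ ((c : ℝ) * ξ + d) ^ 2 + (|2 * (c : ℝ) * d| + |(c : ℝ) ^ 2|) * k := by positivity
      linarith
    have hk₂0 : 0 < k₂ := by positivity
    have hlin : ∀ u v x y Δ : ℝ, |x| ≤ Δ → |y| ≤ Δ → |u * x + v * y| ≤ (|u| + |v|) * Δ := by
      intro u v x y Δ hx hy
      calc |u * x + v * y| ≤ |u * x| + |v * y| := abs_add_le _ _
        _ = |u| * |x| + |v| * |y| := by rw [abs_mul, abs_mul]
        _ ≤ |u| * Δ + |v| * Δ := by gcongr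
        _ = _ := by ring
    have hexp : (0 : ℝ) < 1 / gam := by have := gam_pos; positivity
    have hsmall : ∀ X : ℝ, 1 ≤ X → X < k₁ → 1 ≤ k₁ ^ (1 / gam) * X ^ (-1 / gam) := by
      intro X hX hXk
      rw [neg_div, Real.rpow_neg (by linarith), ← div_eq_mul_inv, one_le_div (by positivity)]
      exact Real.rpow_le_rpow (by linarith) hXk.le hexp.le
    refine ⟨(k₂ * k + 1) * k₁ ^ (1 / gam), by positivity, fun X hX => ?_⟩
    rcases lt_or_ge X k₁ with hXk | hXk
    · refine ⟨0, 0, 1, by simp, by simp; linarith, ?_, ?_⟩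
      · simp only [Int.cast_zero, zero_mul, sub_zero, abs_zero]
        positivity
      · have := hsmall X hX hXk
        have h2 : 0 ≤ k₂ * k * (k₁ ^ (1 / gam) * X ^ (-1 / gam)) := by positivity
        simp only [Int.cast_zero, zero_mul, Int.cast_one, zero_sub, abs_neg, abs_one]
        linarith
    · have hY : 1 ≤ X / k₁ := by rwa [one_le_div (by linarith)]
      have hYpow : (X / k₁) ^ (-1 / gam) = k₁ ^ (1 / gam) * X ^ (-1 / gam) := by
        rw [Real.div_rpow (by linarith) (by linarith), neg_div, Real.rpow_neg (x := k₁)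
          (by linarith), div_inv_eq_mul, mul_comm]
      have hYle : (X / k₁) ^ (-1 / gam) ≤ 1 := by
        rw [neg_div]
        exact Real.rpow_le_one_of_one_le_of_nonpos hY (by linarith)
      obtain ⟨x₀, x₁, x₂, hne, hx₀, hx₁, hx₂⟩ := happ (X / k₁) hY
      set Δ : ℝ := k * (X / k₁) ^ (-1 / gam) with hΔ
      have hΔ0 : 0 ≤ Δ := by positivity
      have hΔk : Δ ≤ k := mul_le_of_le_one_right hk.le hYle
      have hfin : k₂ * Δ ≤ (k₂ * k + 1) * k₁ ^ (1 / gam) * X ^ (-1 / gam) := by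
        rw [hΔ, hYpow]
        have : 0 ≤ k₁ ^ (1 / gam) * X ^ (-1 / gam) := by positivity
        linarith
      refine ⟨d ^ 2 * x₀ + 2 * c * d * x₁ + c ^ 2 * x₂,
        b * d * x₀ + (a * d + b * c) * x₁ + a * c * x₂,
        b ^ 2 * x₀ + 2 * a * b * x₁ + a ^ 2 * x₂, ?_, ?_, ?_, ?_⟩
      · rintro ⟨e₁, e₂, e₃⟩
        refine hne ⟨?_, ?_, ?_⟩
        · linear_combination a ^ 2 * e₁ - 2 * a * c * e₂ + c ^ 2 * e₃ - x₀ * hdet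
        · linear_combination -a * b * e₁ + (a * d + b * c) * e₂ - c * d * e₃ - x₁ * hdet
        · linear_combination b ^ 2 * e₁ - 2 * b * d * e₂ + d ^ 2 * e₃ - x₂ * hdet
      · have hl := hlin (2 * c * d) (c ^ 2) _ _ Δ hx₁ hx₂
        have e : ((d ^ 2 * x₀ + 2 * c * d * x₁ + c ^ 2 * x₂ : ℤ) : ℝ) = (c * ξ + d) ^ 2 * x₀ -
            (2 * c * d * (x₀ * ξ - x₁) + c ^ 2 * (x₀ * ξ ^ 2 - x₂)) := by push_cast; ring
        have e' : |((c : ℝ) * ξ + d) ^ 2 * x₀| ≤ (c * ξ + d) ^ 2 * (X / k₁) := by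
          rw [abs_mul, abs_of_nonneg (sq_nonneg _)]; gcongr
        rw [e]
        calc _ ≤ _ := abs_sub _ _
          _ ≤ (c * ξ + d) ^ 2 * (X / k₁) + (|2 * (c : ℝ) * d| + |(c : ℝ) ^ 2|) * k * 1 := by
            rw [mul_one]; refine add_le_add e' (hl.trans ?_); gcongr
          _ ≤ (c * ξ + d) ^ 2 * (X / k₁) + (|2 * (c : ℝ) * d| + |(c : ℝ) ^ 2|) * k * (X / k₁) +
              1 * (X / k₁) := by
            have : (|2 * (c : ℝ) * d| + |(c : ℝ) ^ 2|) * k * 1 ≤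
              (|2 * (c : ℝ) * d| + |(c : ℝ) ^ 2|) * k * (X / k₁) := by gcongr
            linarith
          _ = k₁ * (X / k₁) := by rw [hk₁]; ring
          _ = X := by field_simp
      · have hl := hlin ((a : ℝ) * d + b * c - 2 * c * d * η) ((a : ℝ) * c - c ^ 2 * η) _ _ Δ hx₁ hx₂
        refine le_trans (le_of_eq_of_le ?_ hl) (le_trans ?_ hfin)
        · congr 1
          push_cast
          linear_combination (x₀ : ℝ) * (c * ξ + d) * hηD
        · gcongr
          rw [hk₂]
          linarith [abs_nonneg (2 * (a : ℝ) * b - 2 * c * d * η ^ 2),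
            abs_nonneg ((a : ℝ) ^ 2 - c ^ 2 * η ^ 2)]
      · have hl := hlin (2 * (a : ℝ) * b - 2 * c * d * η ^ 2) ((a : ℝ) ^ 2 - c ^ 2 * η ^ 2)
          _ _ Δ hx₁ hx₂
        refine le_trans (le_of_eq_of_le ?_ hl) (le_trans ?_ hfin)
        · congr 1
          push_cast
          linear_combination (x₀ : ℝ) * (η * (c * ξ + d) + a * ξ + b) * hηD
        · gcongr
          rw [hk₂]
          linarith [abs_nonneg ((a : ℝ) * d + b * c - 2 * c * d * η),
            abs_nonneg ((a : ℝ) * c - c ^ 2 * η)]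

/-- The matrix by which Fibonacci sequences are conjugated when `A` acts on the extremal number. -/
def conjMat (A : M2) : M2 := !![A 0 0, -A 1 0; -A 0 1, A 1 1]

/-- The inverse of `conjMat A` when `A` has determinant `±1`. -/
def conjMatInv (A : M2) : M2 := A.det • !![A 1 1, A 1 0; A 0 1, A 0 0]

theorem InGL2Z.det_mul_det {A : M2} (hA : InGL2Z A) : A.det * A.det = 1 := by
  rcases hA with h | h <;> simp [h]

theorem InGL2Z.conjMat_mul_conjMatInv {A : M2} (hA : InGL2Z A) :
    conjMat A * conjMatInv A = 1 := by
  have h := hA.det_mul_det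
  rw [det_fin_two] at h
  ext i j
  fin_cases i <;> fin_cases j <;>
    simp [conjMat, conjMatInv, det_fin_two] <;> first | linear_combination h | ring

theorem InGL2Z.conjMatInv_mul_conjMat {A : M2} (hA : InGL2Z A) :
    conjMatInv A * conjMat A = 1 := by
  have h := hA.det_mul_det
  rw [det_fin_two] at h
  ext i j
  fin_cases i <;> fin_cases j <;>
    simp [conjMat, conjMatInv, det_fin_two] <;> first | linear_combination h | ring

theorem xiNorm_conjMatInv_mul {ξ : ℝ} {A : M2} (hA : InGL2Z A)
    (hD : (A 1 0 : ℝ) * ξ + A 1 1 ≠ 0) (Y : M2) :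
    xiNorm (((A 0 0 : ℝ) * ξ + (A 0 1 : ℝ)) / ((A 1 0 : ℝ) * ξ + (A 1 1 : ℝ)))
      (conjMatInv A * Y) = |(A 1 0 : ℝ) * ξ + A 1 1|⁻¹ * xiNorm ξ Y := by
  have h : ((A.det : ℤ) : ℝ) * A.det = 1 := by exact_mod_cast hA.det_mul_det
  have hd : ((A.det : ℤ) : ℝ) = A 0 0 * A 1 1 - A 0 1 * A 1 0 := by
    rw [det_fin_two]; push_cast; ring
  have key : ∀ j, ((A 0 0 : ℝ) * ξ + (A 0 1 : ℝ)) / ((A 1 0 : ℝ) * ξ + (A 1 1 : ℝ)) *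
      ((conjMatInv A * Y) 0 j : ℝ) - ((conjMatInv A * Y) 1 j : ℝ) =
      ((A 1 0 : ℝ) * ξ + A 1 1)⁻¹ * (ξ * Y 0 j - Y 1 j) := by
    intro j
    have e₀ : ((conjMatInv A * Y) 0 j : ℝ) = A.det * (A 1 1 * Y 0 j + A 1 0 * Y 1 j) := by
      simp [conjMatInv, mul_apply, Fin.sum_univ_two]; ring
    have e₁ : ((conjMatInv A * Y) 1 j : ℝ) = A.det * (A 0 1 * Y 0 j + A 0 0 * Y 1 j) := by
      simp [conjMatInv, mul_apply, Fin.sum_univ_two]; ring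
    rw [e₀, e₁]
    apply mul_left_cancel₀ hD
    linear_combination (A.det * (A 1 1 * Y 0 j + A 1 0 * Y 1 j)) *
      div_mul_cancel₀ ((A 0 0 : ℝ) * ξ + A 0 1) hD - (ξ * Y 0 j - Y 1 j) * mul_inv_cancel₀ hD +
      A.det * (Y 1 j - ξ * Y 0 j) * hd + (ξ * Y 0 j - Y 1 j) * h
  unfold xiNorm
  rw [key, key, abs_mul, abs_mul, abs_inv, mul_max_of_nonneg _ _ (by positivity)]

theorem HasGLAssoc.mobius {ξ : ℝ} (h : HasGLAssoc ξ) {A : M2} (hA : InGL2Z A) :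
    HasGLAssoc (((A 0 0 : ℝ) * ξ + (A 0 1 : ℝ)) / ((A 1 0 : ℝ) * ξ + (A 1 1 : ℝ))) := by
  obtain ⟨hξ, W, hW, hG⟩ := h
  have hD := hξ.linear_ne_zero hA.row_ne_zero
  exact ⟨hξ.mobius hA, _, hW.conj hG hA.conjMat_mul_conjMatInv hA.conjMatInv_mul_conjMat
    (inv_pos.mpr (abs_pos.mpr hD)) (xiNorm_conjMatInv_mul hA hD) 0 (s := fun _ => 1)
    (fun _ _ => Or.inl rfl) (fun _ _ => by norm_num)⟩

/-- The first rows of the terms of an associated sequence stay away from the direction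
orthogonal to `(1, ξ)`. -/
theorem IsAssociated.exists_mul_mnorm_le {ξ : ℝ} {W : ℕ → M2} (hW : IsAssociated ξ W)
    (hG : ∀ i, 1 ≤ i → InGL2Z (W i)) :
    ∃ δ : ℝ, 0 < δ ∧ ∃ i₀, 1 ≤ i₀ ∧ ∀ j, i₀ ≤ j →
      δ * mnorm (W j) ≤ |(W j 0 0 : ℝ) + W j 0 1 * ξ| := by
  have hgrow := hW.eventually_le_mnorm
  obtain ⟨hF, -, -, c₁, c₂, c₃, c₄, c₅, c₆, p₁, p₂, p₃, p₄, -, -, h⟩ := hW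
  set κ : ℝ := c₁ * c₁ ^ (gam - 1) with hκ
  have hκ0 : 0 < κ := by positivity
  obtain ⟨i, hi, hL⟩ := hgrow (8 * (1 + |ξ|) * c₄ / κ)
  refine ⟨κ / (2 * (1 + |ξ|)), by positivity, i + 1, by omega, fun j hj => ?_⟩
  obtain ⟨j, rfl⟩ : ∃ k, j = k + 1 := ⟨j - 1, by omega⟩
  have hj1 : 1 ≤ j := by omega
  have n₁ := one_le_mnorm (hG j hj1)
  have n₂ := one_le_mnorm (hG (j + 1) (by omega))
  have l₁ := hL j (by omega)
  have l₂ := hL (j + 1) (by omega)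
  have hprod : κ * mnorm (W j) * mnorm (W (j + 1)) ≤ mnorm (W (j + 2)) := by
    refine le_trans ?_ (h (j + 1) (by omega)).1
    have hg := one_lt_gam
    have e : mnorm (W (j + 1)) ^ gam = mnorm (W (j + 1)) ^ (gam - 1) * mnorm (W (j + 1)) := by
      rw [← Real.rpow_add_one (by linarith)]; congr 1; ring
    have e' : c₁ ^ (gam - 1) * mnorm (W j) ≤ mnorm (W (j + 1)) ^ (gam - 1) := by
      have := Real.rpow_le_rpow (z := gam - 1) (by positivity) (h j hj1).1 (by linarith)
      rwa [Real.mul_rpow p₁.le (by positivity), ← Real.rpow_mul (by linarith),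
        gam_mul_gam_sub_one, Real.rpow_one] at this
    rw [e]
    calc κ * mnorm (W j) * mnorm (W (j + 1))
        = c₁ * (c₁ ^ (gam - 1) * mnorm (W j) * mnorm (W (j + 1))) := by rw [hκ]; ring
      _ ≤ _ := by gcongr
  have herr : ∀ k, 1 ≤ k → ∀ l, |ξ * (W k 0 l : ℝ) - W k 1 l| ≤ c₄ := by
    intro k hk l
    have hx : |ξ * (W k 0 l : ℝ) - W k 1 l| ≤ xiNorm ξ (W k) := by
      fin_cases l
      · exact le_max_left _ _
      · exact le_max_right _ _
    have := (h k hk).2.2.2.1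
    have h1 := inv_le_one_of_one_le₀ (one_le_mnorm (hG k hk))
    calc _ ≤ _ := hx.trans this
      _ ≤ c₄ * 1 := by gcongr
      _ = c₄ := mul_one _
  set t : ℝ := (W (j + 1) 0 0 : ℝ) + W (j + 1) 0 1 * ξ with ht
  set n : ℝ := mnorm (W j) with hn
  set n' : ℝ := mnorm (W (j + 1)) with hn'
  have hrow₀ : ∀ l, |(W (j + 2) 0 l : ℝ)| ≤ n * |t| + n' * c₄ := by
    intro l
    have e : (W (j + 2) 0 l : ℝ) =
        W j 0 l * t - W (j + 1) 0 1 * (ξ * (W j 0 l : ℝ) - W j 1 l) := by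
      rw [hF.eq_mul hG hj1, mul_apply, Fin.sum_univ_two, ht]; push_cast; ring
    rw [e]
    refine (abs_sub _ _).trans (add_le_add ?_ ?_)
    · rw [abs_mul]; gcongr; exact abs_le_mnorm _ _ _
    · rw [abs_mul]
      exact mul_le_mul (abs_le_mnorm _ _ _) (herr j hj1 l) (abs_nonneg _) (by linarith)
  have hrow₁ : ∀ l, |(W (j + 2) 1 l : ℝ)| ≤ |ξ| * (n * |t| + n' * c₄) + 2 * c₄ * n := by
    intro l
    have e : (W (j + 2) 1 l : ℝ) = ξ * W (j + 2) 0 l -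
        ((ξ * (W (j + 1) 0 0 : ℝ) - W (j + 1) 1 0) * W j 0 l +
          (ξ * (W (j + 1) 0 1 : ℝ) - W (j + 1) 1 1) * W j 1 l) := by
      rw [hF.eq_mul hG hj1, mul_apply, mul_apply, Fin.sum_univ_two, Fin.sum_univ_two]
      push_cast; ring
    rw [e]
    refine (abs_sub _ _).trans (add_le_add ?_ ?_)
    · rw [abs_mul]; gcongr; exact hrow₀ l
    · exact abs_mul_add_mul_le (herr _ (by omega) _) (herr _ (by omega) _) (abs_le_mnorm _ _ _)
        (abs_le_mnorm _ _ _)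
  have hup : mnorm (W (j + 2)) ≤ (1 + |ξ|) * (n * |t| + n' * c₄) + 2 * c₄ * n := by
    have hA : 0 ≤ n * |t| + n' * c₄ := by positivity
    have hB : 0 ≤ |ξ| * (n * |t| + n' * c₄) := by positivity
    have hC : 0 ≤ 2 * c₄ * n := by positivity
    rw [mnorm_le_iff, Fin.forall_fin_two]
    exact ⟨fun l => (hrow₀ l).trans (by linarith), fun l => (hrow₁ l).trans (by linarith)⟩
  have hcomb := hprod.trans hup
  rw [div_le_iff₀ hκ0] at l₁ l₂
  have m₁ : 8 * (1 + |ξ|) * c₄ * n' ≤ n * κ * n' := by gcongr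
  have m₂ : 8 * (1 + |ξ|) * c₄ * n ≤ n' * κ * n := by gcongr
  have m₃ : 0 ≤ |ξ| * c₄ * n := by positivity
  have m₀ : 0 ≤ n * κ * n' := by positivity
  have m₄ : n * (κ * n') ≤ n * (2 * (1 + |ξ|) * |t|) := by linarith
  have m₅ := le_of_mul_le_mul_left m₄ (by linarith)
  rw [div_mul_eq_mul_div, div_le_iff₀ (by positivity)]
  linarith

/-- The pairs `(q, p)`, `(q', p')` behave like consecutive convergents of `ξ`. -/
structure IsConvergentPair (ξ : ℝ) (q p q' p' s : ℤ) : Prop where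
  det : q * p' - p * q' = 1 ∨ q * p' - p * q' = -1
  sign : s = 1 ∨ s = -1
  nonneg : 0 ≤ q'
  one_le : 1 ≤ q
  le : q' ≤ q
  pos : 0 < (s : ℝ) * (q * ξ - p)
  lt : (s : ℝ) * (q * ξ - p) < s * (p' - q' * ξ)
  le_one : (s : ℝ) * (p' - q' * ξ) ≤ 1

theorem IsConvergentPair.next {ξ : ℝ} (hξ : ∀ c d : ℤ, ¬(c = 0 ∧ d = 0) → (c : ℝ) * ξ + d ≠ 0)
    {q p q' p' s : ℤ} (h : IsConvergentPair ξ q p q' p' s) :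
    ∃ q'' p'' : ℤ, q + q' ≤ q'' ∧ IsConvergentPair ξ q'' p'' q p (-s) := by
  obtain ⟨hd, hs, h0, h1, hle, hpos, hlt, hone⟩ := h
  set e : ℝ := s * (q * ξ - p) with he
  set e' : ℝ := s * (p' - q' * ξ) with he'
  set n : ℤ := ⌊e' / e⌋ with hn
  have hn1 : 1 ≤ n := by
    rw [hn, Int.le_floor, Int.cast_one, one_le_div hpos]; exact hlt.le
  have hn2 : (n : ℝ) * e ≤ e' := (le_div_iff₀ hpos).mp (Int.floor_le _)
  have hn3 : e' < (n + 1) * e := (div_lt_iff₀ hpos).mp (Int.lt_floor_add_one _)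
  have hnq : q ≤ n * q := le_mul_of_one_le_left (by omega) hn1
  have hs0 : (s : ℝ) ≠ 0 := by rcases hs with rfl | rfl <;> norm_num
  have hne : (n : ℝ) * e ≠ e' := by
    intro heq
    refine hξ (n * q + q') (-(n * p + p')) (by omega) ?_
    refine mul_left_cancel₀ hs0 ?_
    push_cast
    linear_combination heq + (n : ℝ) * (-he) + he'
  have hn4 := lt_of_le_of_ne hn2 hne
  refine ⟨n * q + q', n * p + p', by omega, ?_, by omega, by omega, by omega, by omega, ?_, ?_, ?_⟩
  · have : (n * q + q') * p - (n * p + p') * q = -(q * p' - p * q') := by ring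
    rw [this]; omega
  all_goals push_cast
  · linarith
  · linarith
  · linarith

theorem exists_isConvergentPair {ξ : ℝ} (hξ : ∀ c d : ℤ, ¬(c = 0 ∧ d = 0) → (c : ℝ) * ξ + d ≠ 0)
    (K : ℕ) : ∃ q p q' p' s : ℤ, IsConvergentPair ξ q p q' p' s ∧ K ≤ q' ∧ K ≤ q - q' := by
  have key : ∃ q p q' p' s : ℤ, IsConvergentPair ξ q p q' p' s ∧ K ≤ q' := by
    induction K with
    | zero =>
      refine ⟨1, ⌊ξ⌋, 0, 1, 1, ⟨by norm_num, by norm_num, by norm_num, by norm_num, by norm_num,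
        ?_, ?_, by norm_num⟩, by norm_num⟩
      · have h1 := Int.floor_le ξ
        have h2 := hξ 1 (-⌊ξ⌋) (by simp)
        push_cast at h2 ⊢
        have h3 : ξ ≠ ⌊ξ⌋ := fun h => h2 (by linarith)
        linarith [lt_of_le_of_ne h1 h3.symm]
      · push_cast
        linarith [Int.lt_floor_add_one ξ]
    | succ K ih =>
      obtain ⟨q, p, q', p', s, h, hK⟩ := ih
      obtain ⟨q₁, p₁, hle₁, h₁⟩ := h.next hξ
      obtain ⟨q₂, p₂, hle₂, h₂⟩ := h₁.next hξ
      refine ⟨_, _, _, _, _, h₂, ?_⟩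
      have := h.one_le
      push_cast
      omega
  obtain ⟨q, p, q', p', s, h, hK⟩ := key
  obtain ⟨q₁, p₁, hle, h₁⟩ := h.next hξ
  exact ⟨_, _, _, _, _, h₁, hK.trans h.le, by omega⟩

/-- A strict version of the inequalities defining `Sset`. -/
structure IsDominant (V : M2) : Prop where
  lt_row₀ : V 0 1 < V 0 0
  lt_col₀ : V 1 0 < V 0 0
  lt_col₁ : V 1 1 < V 0 1
  lt_row₁ : V 1 1 < V 1 0
  pos : 0 < V 1 1

theorem IsDominant.mul_pos {V V' : M2} (h : IsDominant V) (h' : IsDominant V') :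
    0 < (V * V') 0 0 := by
  obtain ⟨a, b, c, d, e⟩ := h
  obtain ⟨a', b', c', d', e'⟩ := h'
  rw [mul_apply, Fin.sum_univ_two]
  have h1 : 0 < V 0 0 * V' 0 0 := _root_.mul_pos (by omega) (by omega)
  have h2 : 0 < V 0 1 * V' 1 0 := _root_.mul_pos (by omega) (by omega)
  omega

theorem IsDominant.mem_Sset {V : M2} (h : IsDominant V) (hG : InGL2Z V) : V ∈ Sset := by
  refine ⟨?_, hG⟩
  simp only [S1, Set.mem_ofPred_eq, map_apply, max_le_iff, le_min_iff, Int.cast_le,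
    Int.cast_nonneg_iff]
  exact ⟨⟨h.lt_row₀.le, h.lt_col₀.le⟩, ⟨h.lt_col₁.le, h.lt_row₁.le⟩, h.pos.le⟩

theorem IsDominant.sign_smul {V : M2} {σ : ℤ} (hσ : σ = 1 ∨ σ = -1) (h : IsDominant (σ • V)) :
    σ = (V 0 0).sign := by
  have h0 : 0 < (σ • V) 0 0 := by
    have := h.pos; have := h.lt_row₁; have := h.lt_col₀; omega
  rcases hσ with rfl | rfl
  · rw [Int.sign_eq_one_of_pos (by simpa using h0)]
  · rw [Int.sign_eq_neg_one_of_neg (by simpa using h0)]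

/-- The shape of a conjugate by a convergent pair: a rank one main term plus an error. -/
theorem dominant_real {x y r₁ r₂ n E w₀₀ w₀₁ w₁₀ w₁₁ : ℝ} (hy : 0 < y) (hxy : y < x)
    (hr₂ : n ≤ r₂) (hr : n ≤ r₁ - r₂) (hn : 0 < n) (hE₀ : 2 * E < y * n)
    (hE₁ : 2 * E < (x - y) * n) (hE : 0 ≤ E)
    (h₀₀ : |w₀₀ - x * r₁| ≤ E) (h₀₁ : |w₀₁ - x * r₂| ≤ E) (h₁₀ : |w₁₀ - y * r₁| ≤ E)
    (h₁₁ : |w₁₁ - y * r₂| ≤ E) :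
    w₀₁ < w₀₀ ∧ w₁₀ < w₀₀ ∧ w₁₁ < w₀₁ ∧ w₁₁ < w₁₀ ∧ 0 < w₁₁ := by
  rw [abs_le] at h₀₀ h₀₁ h₁₀ h₁₁
  have e₁ : y * n ≤ y * (r₁ - r₂) := by gcongr
  have e₂ : (x - y) * n ≤ (x - y) * r₂ := mul_le_mul_of_nonneg_left hr₂ (by linarith)
  have e₃ : (x - y) * n ≤ (x - y) * r₁ := mul_le_mul_of_nonneg_left (by linarith) (by linarith)
  have e₄ : y * n ≤ y * r₂ := by gcongr
  have e₅ : (x - y) * n ≤ (x - y) * (r₁ - r₂) := mul_le_mul_of_nonneg_left hr (by linarith)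
  have e₆ : 0 < (x - y) * n := _root_.mul_pos (by linarith) hn
  refine ⟨?_, ?_, ?_, ?_, ?_⟩ <;> linarith

/-- Conjugation by a suitable convergent pair makes almost all terms of an associated sequence
dominant up to sign. -/
theorem IsAssociated.exists_dominant {ξ : ℝ} (hξ : IsExtremal ξ) {W : ℕ → M2}
    (hW : IsAssociated ξ W) (hG : ∀ i, 1 ≤ i → InGL2Z (W i)) :
    ∃ A : M2, InGL2Z A ∧ ∃ i₀ : ℕ, ∀ j, i₀ ≤ j → ∃ σ : ℤ, (σ = 1 ∨ σ = -1) ∧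
      IsDominant (σ • (conjMatInv A * W j * conjMat A)) := by
  obtain ⟨δ, hδ, i₁, hi₁, hdir⟩ := hW.exists_mul_mnorm_le hG
  obtain ⟨K, hK⟩ := exists_nat_ge (3 / δ)
  have hKδ : 3 ≤ K * δ := (div_le_iff₀ hδ).mp hK
  obtain ⟨q, p, q', p', s, hc, hKq', hKq⟩ :=
    exists_isConvergentPair (fun c d => hξ.linear_ne_zero) K
  have hgrow := hW.eventually_le_mnorm
  obtain ⟨-, -, -, c₁, c₂, c₃, c₄, c₅, c₆, p₁, p₂, p₃, p₄, -, -, h⟩ := hW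
  obtain ⟨hdet, hs, hq'0, hq1, hqq', hy, hxy, hx⟩ := hc
  set y : ℝ := s * (q * ξ - p) with hyd
  set x : ℝ := s * (p' - q' * ξ) with hxd
  set A : M2 := !![q, -p; -q', p'] with hA
  have hdetA : A.det = q * p' - p * q' := by rw [hA, det_fin_two_of]; ring
  have hAG : InGL2Z A := by rw [InGL2Z, hdetA]; exact hdet
  set H : ℝ := |(q : ℝ)| + |(p : ℝ)| + |(q' : ℝ)| + |(p' : ℝ)| with hH
  have hqH : |(q : ℝ)| ≤ H := by
    linarith [abs_nonneg (p : ℝ), abs_nonneg (q' : ℝ), abs_nonneg (p' : ℝ)]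
  have hpH : |(p : ℝ)| ≤ H := by
    linarith [abs_nonneg (q : ℝ), abs_nonneg (q' : ℝ), abs_nonneg (p' : ℝ)]
  have hqH' : |(q' : ℝ)| ≤ H := by
    linarith [abs_nonneg (p : ℝ), abs_nonneg (q : ℝ), abs_nonneg (p' : ℝ)]
  have hpH' : |(p' : ℝ)| ≤ H := by
    linarith [abs_nonneg (p : ℝ), abs_nonneg (q' : ℝ), abs_nonneg (q : ℝ)]
  have hH0 : 0 ≤ H := by positivity
  set E : ℝ := H * (2 * c₄ * H) with hE
  have hE0 : 0 ≤ E := by positivity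
  obtain ⟨i₂, -, hL⟩ := hgrow (2 * E / y + 2 * E / (x - y) + 1)
  refine ⟨A, hAG, max i₁ i₂, fun j hj => ?_⟩
  have hj1 : 1 ≤ j := hi₁.trans ((le_max_left _ _).trans hj)
  have hdj := hdir j ((le_max_left _ _).trans hj)
  have hLj := hL j ((le_max_right _ _).trans hj)
  have hn1 := one_le_mnorm (hG j hj1)
  have ha := abs_le_mnorm (W j) 0 1
  have herr : xiNorm ξ (W j) ≤ c₄ := by
    calc _ ≤ c₄ * (mnorm (W j))⁻¹ := (h j hj1).2.2.2.1
      _ ≤ c₄ * 1 := by gcongr; exact inv_le_one_of_one_le₀ hn1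
      _ = c₄ := mul_one _
  have he₀ : |ξ * (W j 0 0 : ℝ) - W j 1 0| ≤ c₄ := (le_max_left _ _).trans herr
  have he₁ : |ξ * (W j 0 1 : ℝ) - W j 1 1| ≤ c₄ := (le_max_right _ _).trans herr
  set n : ℝ := mnorm (W j) with hn
  set t : ℝ := (W j 0 0 : ℝ) + W j 0 1 * ξ with ht
  obtain ⟨ε, hε, hεt⟩ : ∃ ε : ℤ, (ε = 1 ∨ ε = -1) ∧ (ε : ℝ) * t = |t| := by
    rcases le_total 0 t with h0 | h0
    · exact ⟨1, by simp, by simp [abs_of_nonneg h0]⟩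
    · exact ⟨-1, by simp, by simp [abs_of_nonpos h0]⟩
  have hσ : s * ε * A.det = 1 ∨ s * ε * A.det = -1 := by
    rcases hs with h1 | h1 <;> rcases hε with h2 | h2 <;> rcases hAG with h3 | h3 <;>
      simp [h1, h2, h3]
  refine ⟨s * ε * A.det, hσ, ?_⟩
  have habs : ∀ {k : ℤ}, k = 1 ∨ k = -1 → |(k : ℝ)| = 1 := by
    rintro k (rfl | rfl) <;> simp
  have hsq : ∀ {k : ℤ}, k = 1 ∨ k = -1 → (k : ℝ) * k = 1 := by
    rintro k (rfl | rfl) <;> simp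
  have hdd := hsq hAG
  have hss := hsq hs
  have hyn : 2 * E < y * n := by
    have : 2 * E / y < n := by
      have : 0 ≤ 2 * E / (x - y) := div_nonneg (by linarith) (by linarith)
      linarith
    rw [div_lt_iff₀ hy] at this; linarith
  have hxyn : 2 * E < (x - y) * n := by
    have : 2 * E / (x - y) < n := by
      have : 0 ≤ 2 * E / y := by positivity
      linarith
    rw [div_lt_iff₀ (by linarith)] at this; linarith
  have hR₁ : ε * (W j 0 0 * q + W j 0 1 * p) = q * |t| - ε * W j 0 1 * (s * y) := by
    rw [← hεt, hyd, ht]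
    linear_combination (-(ε : ℝ) * W j 0 1 * (p - q * ξ)) * hss
  have hR₂ : ε * (W j 0 0 * q' + W j 0 1 * p') = q' * |t| + ε * W j 0 1 * (s * x) := by
    rw [← hεt, hxd, ht]
    linear_combination (-(ε : ℝ) * W j 0 1 * (p' - q' * ξ)) * hss
  have hsmall : ∀ z : ℝ, 0 ≤ z → z ≤ 1 → |ε * W j 0 1 * (s * z)| ≤ n := by
    intro z hz hz1
    rw [abs_mul, abs_mul, abs_mul, habs hε, habs hs, one_mul, one_mul, abs_of_nonneg hz]
    calc _ ≤ n * 1 := by gcongr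
      _ = n := mul_one n
  have hs₁ := abs_le.mp (hsmall y hy.le (by linarith))
  have hs₂ := abs_le.mp (hsmall x (by linarith) hx)
  have hbig : ∀ m : ℤ, (K : ℤ) ≤ m → 3 * n ≤ m * |t| := by
    intro m hm
    have hm' : (K : ℝ) ≤ m := by exact_mod_cast hm
    have hm0 : (0 : ℝ) ≤ m := (Nat.cast_nonneg K).trans hm'
    calc 3 * n ≤ K * δ * n := by gcongr
      _ = K * (δ * n) := by ring
      _ ≤ m * |t| := by gcongr
  have hb₁ := hbig q' hKq'
  have hb₂ := hbig (q - q') hKq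
  push_cast at hb₂
  have herrE : ∀ k u v : ℤ, |(k : ℝ)| ≤ H → |(u : ℝ)| ≤ H → |(v : ℝ)| ≤ H →
      |(s * ε : ℝ) * (k * ((ξ * (W j 0 0 : ℝ) - W j 1 0) * u +
        (ξ * (W j 0 1 : ℝ) - W j 1 1) * v))| ≤ E := by
    intro k u v hk hu hv
    rw [abs_mul, abs_mul, abs_mul, habs hε, habs hs, one_mul, one_mul]
    exact mul_le_mul hk (abs_mul_add_mul_le he₀ he₁ hu hv) (abs_nonneg _) hH0
  have hent : ∀ i k, (((s * ε * A.det) • (conjMatInv A * W j * conjMat A)) i k : ℝ) =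
      s * ε * (!![p', -q'; -p, q] * W j * !![q, q'; p, p']) i k := by
    intro i k
    have e₁ : conjMatInv A = A.det • !![p', -q'; -p, q] := by simp [conjMatInv, hA]
    have e₂ : conjMat A = !![q, q'; p, p'] := by simp [conjMat, hA]
    rw [e₁, e₂, Matrix.smul_mul, Matrix.smul_mul, smul_smul, Matrix.smul_apply, smul_eq_mul]
    simp only [Int.cast_mul]
    linear_combination
      (s * ε : ℝ) * ((!![p', -q'; -p, q] * W j * !![q, q'; p, p']) i k : ℤ) * hdd
  have hfin := dominant_real (r₁ := ε * (W j 0 0 * q + W j 0 1 * p))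
    (r₂ := ε * (W j 0 0 * q' + W j 0 1 * p')) (n := n) (E := E)
    (w₀₀ := (((s * ε * A.det) • (conjMatInv A * W j * conjMat A)) 0 0 : ℤ))
    (w₀₁ := (((s * ε * A.det) • (conjMatInv A * W j * conjMat A)) 0 1 : ℤ))
    (w₁₀ := (((s * ε * A.det) • (conjMatInv A * W j * conjMat A)) 1 0 : ℤ))
    (w₁₁ := (((s * ε * A.det) • (conjMatInv A * W j * conjMat A)) 1 1 : ℤ))
    hy hxy (by rw [hR₂]; linarith) (by rw [hR₁, hR₂]; linarith) (by linarith) hyn hxyn hE0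
    (le_of_eq_of_le (congrArg _ ?_) (herrE q' q p hqH' hqH hpH))
    (le_of_eq_of_le (congrArg _ ?_) (herrE q' q' p' hqH' hqH' hpH'))
    (le_of_eq_of_le (congrArg _ ?_) (herrE (-q) q p (by simpa using hqH) hqH hpH))
    (le_of_eq_of_le (congrArg _ ?_) (herrE (-q) q' p' (by simpa using hqH) hqH' hpH'))
  · obtain ⟨f₁, f₂, f₃, f₄, f₅⟩ := hfin
    exact ⟨by exact_mod_cast f₁, by exact_mod_cast f₂, by exact_mod_cast f₃,
      by exact_mod_cast f₄, by exact_mod_cast f₅⟩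
  all_goals
    rw [hent]
    simp only [mul_apply, Fin.sum_univ_two, of_apply, cons_val', cons_val_zero, cons_val_one,
      cons_val_fin_one, hxd, hyd]
    push_cast
    ring

theorem HasGLAssoc.exists_hasSAssoc {ξ : ℝ} (h : HasGLAssoc ξ) : ∃ A : M2, InGL2Z A ∧
    HasSAssoc (((A 0 0 : ℝ) * ξ + (A 0 1 : ℝ)) / ((A 1 0 : ℝ) * ξ + (A 1 1 : ℝ))) := by
  obtain ⟨hξ, W, hW, hG⟩ := h
  obtain ⟨A, hA, m, hdom⟩ := hW.exists_dominant hξ hG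
  have hD := hξ.linear_ne_zero hA.row_ne_zero
  have hinv := hA.conjMat_mul_conjMatInv
  set V : ℕ → M2 := fun j => conjMatInv A * W j * conjMat A with hV
  have hmul : ∀ j, 1 ≤ j → V (j + 2) = V (j + 1) * V j := by
    intro j hj
    calc V (j + 2) = conjMatInv A * W (j + 1) * 1 * W j * conjMat A := by
          rw [hV]
          simp only
          rw [hW.1.eq_mul hG hj, Matrix.mul_one]
          simp only [Matrix.mul_assoc]
      _ = V (j + 1) * V j := by rw [← hinv]; simp only [hV, Matrix.mul_assoc]
  have hsign : ∀ j, m ≤ j → ((V j 0 0).sign = 1 ∨ (V j 0 0).sign = -1) ∧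
      IsDominant ((V j 0 0).sign • V j) := by
    intro j hj
    obtain ⟨σ, hσ, hd⟩ := hdom j hj
    have := hd.sign_smul hσ
    rw [← this]
    exact ⟨hσ, hd⟩
  have hss : ∀ j, 1 ≤ j → m ≤ j →
      (V (j + 2) 0 0).sign = (V (j + 1) 0 0).sign * (V j 0 0).sign := by
    intro j hj hmj
    have h₀ := hsign j hmj
    have h₁ := hsign (j + 1) (by omega)
    have hp := h₁.2.mul_pos h₀.2
    rw [Matrix.smul_mul, Matrix.mul_smul, smul_smul, ← hmul j hj, Matrix.smul_apply, smul_eq_mul] at hp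
    have := Int.sign_eq_one_of_pos hp
    rw [Int.sign_mul, Int.sign_mul, Int.sign_sign, Int.sign_sign] at this
    rcases h₀.1 with e | e <;> rcases h₁.1 with e' | e' <;> rw [e, e'] at this ⊢ <;> omega
  have hconj := hW.conj hG hinv hA.conjMatInv_mul_conjMat
    (inv_pos.mpr (abs_pos.mpr hD)) (xiNorm_conjMatInv_mul hA hD) m
    (s := fun i => (V (i + 2 * m) 0 0).sign) (fun i _ => (hsign _ (by omega)).1)
    (fun i hi => by
      have := hss (i + 2 * m) (by omega) (by omega)
      rwa [show i + 2 * m + 2 = i + 2 + 2 * m by ring,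
        show i + 2 * m + 1 = i + 1 + 2 * m by ring] at this)
  exact ⟨A, hA, hξ.mobius hA, _, hconj.1, fun i hi =>
    (hsign (i + 2 * m) (by omega)).2.mem_Sset (hconj.2 i hi)⟩

/-- (i) The set of extremal real numbers with an associated Fibonacci sequence in GL₂(ℤ)
is stable under the action of GL₂(ℤ) by linear fractional transformations.
(ii) Any such number is GL₂(ℤ)-conjugate to one with an associated Fibonacci sequence
in 𝒮. -/
theorem stmt10 :
    (∀ ξ : ℝ, HasGLAssoc ξ → ∀ A : M2, InGL2Z A →
      HasGLAssoc (((A 0 0 : ℝ) * ξ + (A 0 1 : ℝ)) / ((A 1 0 : ℝ) * ξ + (A 1 1 : ℝ)))) ∧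
    (∀ ξ : ℝ, HasGLAssoc ξ → ∃ A : M2, InGL2Z A ∧
      HasSAssoc (((A 0 0 : ℝ) * ξ + (A 0 1 : ℝ)) / ((A 1 0 : ℝ) * ξ + (A 1 1 : ℝ)))) := by
  exact ⟨fun _ h _ hA => h.mobius hA, fun _ h => h.exists_hasSAssoc⟩
end

section
/- Let (W_i)_{i≥1} be a Fibonacci sequence in the group (𝒫,*). If W₁ and W₂ have no common eigenvector in ℚ² and satisfy W₁W₂ ≠ W₂W₁ and W₁W₂ ≠ −W₂W₁ (ordinary matrix products), then (W_i)_{i≥1} is an admissible Fibonacci sequence. -/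
open Matrix

theorem content_smul_red (A : M2) : (content A : ℤ) • red A = A := by
  have h : ∀ i j, (content A : ℤ) ∣ A i j := by
    intro i j
    rw [Int.natCast_dvd]
    unfold content
    fin_cases i <;> fin_cases j
    · exact (Nat.gcd_dvd_left _ _).trans (Nat.gcd_dvd_left _ _)
    · exact (Nat.gcd_dvd_left _ _).trans (Nat.gcd_dvd_right _ _)
    · exact (Nat.gcd_dvd_right _ _).trans (Nat.gcd_dvd_left _ _)
    · exact (Nat.gcd_dvd_right _ _).trans (Nat.gcd_dvd_right _ _)
  ext i j
  simpa [red] using Int.mul_ediv_cancel' (h i j)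

theorem content_smul (n : ℕ) (A : M2) : content ((n : ℤ) • A) = n * content A := by
  simp [content, Int.natAbs_mul, Nat.gcd_mul_left]

theorem content_ne_zero {A : M2} (hA : A ≠ 0) : content A ≠ 0 := by
  intro h
  apply hA
  rw [← content_smul_red A, h]
  simp

theorem primitive_red {A : M2} (hA : A ≠ 0) : Primitive (red A) := by
  have h := content_smul (content A) (red A)
  rw [content_smul_red] at h
  exact Nat.eq_of_mul_eq_mul_left (Nat.pos_of_ne_zero (content_ne_zero hA)) (by rw [← h, mul_one])

theorem ne_zero_of_det_ne_zero {A : M2} (hA : A.det ≠ 0) : A ≠ 0 := by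
  rintro rfl
  simp at hA

theorem memP_red {A : M2} (hA : A.det ≠ 0) : MemP (red A) := by
  refine ⟨primitive_red (ne_zero_of_det_ne_zero hA), fun h => hA ?_⟩
  rw [← content_smul_red A, det_smul, h, mul_zero]

theorem isSymm_smul_iff {A : M2} {n : ℤ} (hn : n ≠ 0) : (n • A).IsSymm ↔ A.IsSymm := by
  refine ⟨fun h => smul_right_injective M2 hn ?_, fun h => h.smul n⟩
  simpa only [IsSymm, transpose_smul] using h

theorem isSymm_red_mul_iff {A : M2} (hA : A ≠ 0) (N : M2) :
    (red A * N).IsSymm ↔ (A * N).IsSymm := by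
  conv_rhs => rw [← content_smul_red A, smul_mul_assoc]
  exact (isSymm_smul_iff (Nat.cast_ne_zero.mpr (content_ne_zero hA))).symm

theorem isSymm_mul_red_iff {N : M2} (hN : N ≠ 0) (A : M2) :
    (A * red N).IsSymm ↔ (A * N).IsSymm := by
  conv_rhs => rw [← content_smul_red N, mul_smul_comm]
  exact (isSymm_smul_iff (Nat.cast_ne_zero.mpr (content_ne_zero hN))).symm

theorem transpose_red (A : M2) : (red A)ᵀ = red Aᵀ := by
  have h : content Aᵀ = content A := by
    simp only [content, transpose_apply]
    ac_rfl
  ext i j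
  simp [red, h]

theorem mul_left_cancel_of_det_ne_zero {N X Y : M2} (hN : N.det ≠ 0) (h : N * X = N * Y) :
    X = Y := by
  have h' := congrArg (N.adjugate * ·) h
  simp only [← Matrix.mul_assoc, adjugate_mul, Matrix.smul_mul, Matrix.one_mul] at h'
  exact smul_right_injective M2 hN h'

theorem isSymm_fib_step {A B M : M2} (hA : (A * M).IsSymm) (hB : (B * Mᵀ).IsSymm) :
    (B * A * B * Mᵀ).IsSymm := by
  have h : B * Mᵀ = M * Bᵀ := by simpa [IsSymm] using hB.symm
  have e : B * A * B * Mᵀ = B * (A * M) * Bᵀ := by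
    simp only [Matrix.mul_assoc, h]
  rw [e, IsSymm, transpose_mul, transpose_mul, hA.eq, transpose_transpose]
  simp only [Matrix.mul_assoc]

theorem exists_ne_zero_isSymm (A B C : M2) :
    ∃ N : M2, N ≠ 0 ∧ (A * Nᵀ).IsSymm ∧ (B * N).IsSymm ∧ (C * Nᵀ).IsSymm := by
  let S : Matrix (Fin 4) (Fin 4) ℤ :=
    !![A 1 0, A 1 1, -A 0 0, -A 0 1;
       B 1 0, -B 0 0, B 1 1, -B 0 1;
       C 1 0, C 1 1, -C 0 0, -C 0 1;
       0, 0, 0, 0]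
  obtain ⟨x, hx, hSx⟩ := exists_mulVec_eq_zero_iff.mpr
    (det_eq_zero_of_row_eq_zero (A := S) 3 (by intro j; fin_cases j <;> rfl))
  have h0 := congrFun hSx 0
  have h1 := congrFun hSx 1
  have h2 := congrFun hSx 2
  simp [S, mulVec, dotProduct, Fin.sum_univ_four] at h0 h1 h2
  refine ⟨!![x 0, x 1; x 2, x 3], fun h => hx ?_, ?_, ?_, ?_⟩
  · ext i
    fin_cases i
    · simpa using congrFun (congrFun h 0) 0
    · simpa using congrFun (congrFun h 0) 1
    · simpa using congrFun (congrFun h 1) 0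
    · simpa using congrFun (congrFun h 1) 1
  all_goals
    refine IsSymm.ext fun i j => ?_
    fin_cases i <;> fin_cases j <;> simp [Matrix.mul_apply, Fin.sum_univ_two] <;> linarith

section Field

variable {K : Type*} [Field K]

theorem exists_eq_vecMulVec_of_det_eq_zero {N : Matrix (Fin 2) (Fin 2) K} (hN : N.det = 0) :
    ∃ u v : Fin 2 → K, N = vecMulVec u v := by
  rw [det_fin_two] at hN
  by_cases h0 : N 0 = 0
  · refine ⟨![0, 1], N 1, ?_⟩
    ext i j
    fin_cases i
    · simp [vecMulVec_apply, h0]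
    · simp [vecMulVec_apply]
  · by_cases h00 : N 0 0 = 0
    · have h01 : N 0 1 ≠ 0 := fun h => h0 (by ext j; fin_cases j <;> simpa)
      refine ⟨![1, N 1 1 / N 0 1], N 0, ?_⟩
      ext i j
      fin_cases i <;> fin_cases j <;> simp [vecMulVec_apply] <;> field_simp
      grind
    · refine ⟨![1, N 1 0 / N 0 0], N 0, ?_⟩
      ext i j
      fin_cases i <;> fin_cases j <;> simp [vecMulVec_apply] <;> field_simp
      grind

theorem exists_eq_smul_of_isSymm_vecMulVec {x y : Fin 2 → K} (hy : y ≠ 0)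
    (h : (vecMulVec x y).IsSymm) : ∃ l : K, x = l • y := by
  have h01 : x 1 * y 0 = x 0 * y 1 := h.apply 0 1
  by_cases h0 : y 0 = 0
  · have h1 : y 1 ≠ 0 := fun h1 => hy (by ext i; fin_cases i <;> simpa)
    refine ⟨x 1 / y 1, ?_⟩
    ext i
    fin_cases i <;> simp <;> field_simp
    grind
  · refine ⟨x 0 / y 0, ?_⟩
    ext i
    fin_cases i <;> simp <;> field_simp
    grind

theorem exists_common_eigenvector {A B N : Matrix (Fin 2) (Fin 2) K} (hA : A.det ≠ 0)
    (hB : B.det ≠ 0) (hN : N ≠ 0) (hdet : N.det = 0) (h1 : (A * Nᵀ).IsSymm)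
    (h2 : (B * N).IsSymm) (h3 : (B * A * Nᵀ).IsSymm) :
    ∃ v : Fin 2 → K, v ≠ 0 ∧ (∃ l : K, A *ᵥ v = l • v) ∧ ∃ l : K, B *ᵥ v = l • v := by
  obtain ⟨u, v, rfl⟩ := exists_eq_vecMulVec_of_det_eq_zero hdet
  have hu : u ≠ 0 := by rintro rfl; simp at hN
  have hv : v ≠ 0 := by rintro rfl; simp at hN
  rw [transpose_vecMulVec, mul_vecMulVec] at h1 h3
  rw [mul_vecMulVec] at h2
  obtain ⟨a, ha⟩ := exists_eq_smul_of_isSymm_vecMulVec hu h1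
  obtain ⟨b, hb⟩ := exists_eq_smul_of_isSymm_vecMulVec hv h2
  obtain ⟨c, hc⟩ := exists_eq_smul_of_isSymm_vecMulVec hu h3
  have ha0 : a ≠ 0 := by
    rintro rfl
    exact hv (eq_zero_of_mulVec_eq_zero hA (by simpa using ha))
  have hb0 : b ≠ 0 := by
    rintro rfl
    exact hu (eq_zero_of_mulVec_eq_zero hB (by simpa using hb))
  rw [← mulVec_mulVec, ha, mulVec_smul, hb, smul_smul] at hc
  obtain ⟨t, rfl⟩ : ∃ t : K, v = t • u :=
    ⟨(a * b)⁻¹ * c, by rw [mul_smul, ← hc, inv_smul_smul₀ (mul_ne_zero ha0 hb0)]⟩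
  have ht : t ≠ 0 := by rintro rfl; simp at hv
  refine ⟨u, hu, ⟨t⁻¹ * a, ?_⟩, ⟨b * t, ?_⟩⟩
  · rw [mul_smul, ← ha, mulVec_smul, inv_smul_smul₀ ht]
  · rw [hb, mul_smul]

end Field

theorem mul_comm_of_isSymm {A B N : M2} (hN : N.det ≠ 0) (hs : N = Nᵀ) (h1 : (A * Nᵀ).IsSymm)
    (h2 : (B * N).IsSymm) (h3 : (B * A * Nᵀ).IsSymm) : A * B = B * A := by
  simp only [IsSymm, transpose_mul, ← hs] at h1 h2 h3
  have h : N * (A * B)ᵀ = N * (B * A)ᵀ := by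
    rw [transpose_mul, transpose_mul, h3, ← Matrix.mul_assoc, h2, Matrix.mul_assoc,
      Matrix.mul_assoc, h1]
  exact transpose_injective (mul_left_cancel_of_det_ne_zero hN h)

theorem mul_anticomm_of_isSymm {A B N : M2} (hN : N.det ≠ 0) (hs : N = -Nᵀ)
    (h1 : (A * Nᵀ).IsSymm) (h2 : (B * N).IsSymm) (h3 : (B * A * Nᵀ).IsSymm) :
    A * B = -(B * A) := by
  have ht : Nᵀ = -N := (neg_eq_iff_eq_neg.mpr hs).symm
  simp only [IsSymm, transpose_mul, transpose_transpose] at h1 h2 h3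
  have h : N * (A * B)ᵀ = N * (-(B * A))ᵀ := by
    rw [transpose_neg, transpose_mul, transpose_mul, Matrix.mul_neg, h3, ht, Matrix.mul_neg,
      neg_neg, ← Matrix.mul_assoc, ← neg_neg (N * Bᵀ), ← Matrix.neg_mul N, ← ht, h2,
      Matrix.neg_mul, Matrix.mul_assoc, h1, ht, Matrix.mul_neg, Matrix.mul_neg, neg_neg,
      Matrix.mul_assoc]
  exact transpose_injective (mul_left_cancel_of_det_ne_zero hN h)

theorem isSymm_mul_of_isFibP {W : ℕ → M2} (hFib : IsFibP W) {M : ℕ → M2}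
    (hM : ∀ i, M (i + 1) = (M i)ᵀ) (h1 : (W 1 * M 1).IsSymm) (h2 : (W 2 * M 2).IsSymm)
    (h3 : (W 2 * W 1 * M 1).IsSymm) (i : ℕ) (hi : 1 ≤ i) : (W i * M i).IsSymm := by
  have hM2 : ∀ i, M (i + 2) = M i := fun i => by rw [hM, hM, transpose_transpose]
  have hne : ∀ i, 1 ≤ i → W (i + 1) * W i ≠ 0 := fun i hi =>
    ne_zero_of_det_ne_zero (by
      rw [det_mul]; exact mul_ne_zero (hFib.1 _ (by omega)).2 (hFib.1 _ hi).2)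
  have hrec : ∀ i, 1 ≤ i → ∀ X : M2,
      (W (i + 2) * X).IsSymm ↔ (W (i + 1) * W i * X).IsSymm := fun i hi X => by
    rw [hFib.2 i hi]; exact isSymm_red_mul_iff (hne i hi) X
  suffices H : (W i * M i).IsSymm ∧ (W (i + 1) * M (i + 1)).IsSymm ∧
      (W (i + 2) * M i).IsSymm from H.1
  induction i, hi using Nat.le_induction with
  | base => exact ⟨h1, h2, (hrec 1 le_rfl _).mpr h3⟩
  | succ i hi ih =>
    obtain ⟨ha, hb, hc⟩ := ih
    refine ⟨hb, by rwa [hM2], (hrec (i + 1) (by omega) _).mpr ?_⟩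
    rw [Matrix.mul_assoc, hFib.2 i hi, pmul, isSymm_red_mul_iff (hne i hi), ← Matrix.mul_assoc, hM]
    exact isSymm_fib_step ha (hM i ▸ hb)

/-- If W₁ and W₂ have no common eigenvector in ℚ² and W₁W₂ ≠ ±W₂W₁, then the Fibonacci
sequence they generate in 𝒫 is admissible. -/
theorem stmt11 (W : ℕ → M2) (hFib : IsFibP W)
    (hev : ¬ ∃ v : Fin 2 → ℚ, v ≠ 0 ∧
      (∃ l : ℚ, ((W 1).map (Int.cast : ℤ → ℚ)).mulVec v = l • v) ∧
      (∃ l : ℚ, ((W 2).map (Int.cast : ℤ → ℚ)).mulVec v = l • v))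
    (hc1 : W 1 * W 2 ≠ W 2 * W 1) (hc2 : W 1 * W 2 ≠ -(W 2 * W 1)) :
    AdmissibleFib W := by
  have hd1 := (hFib.1 1 le_rfl).2
  have hd2 := (hFib.1 2 one_le_two).2
  obtain ⟨N, hN, h1, h2, h3⟩ := exists_ne_zero_isSymm (W 1) (W 2) (W 2 * W 1)
  have hdet : N.det ≠ 0 := by
    intro hdet
    have hdetmap : ∀ A : M2, (A.map (Int.cast : ℤ → ℚ)).det = A.det := fun A =>
      ((Int.castRingHom ℚ).map_det A).symm
    have hmul : ∀ A B : M2, (A * B).map (Int.cast : ℤ → ℚ) =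
        A.map (Int.cast : ℤ → ℚ) * B.map (Int.cast : ℤ → ℚ) := fun A B =>
      Matrix.map_mul (f := Int.castRingHom ℚ)
    have hinj : Function.Injective (Int.cast : ℤ → ℚ) := Int.cast_injective
    refine hev (exists_common_eigenvector (N := N.map (Int.cast : ℤ → ℚ)) ?_ ?_ ?_ ?_ ?_ ?_ ?_)
    · rw [hdetmap]; exact_mod_cast hd1
    · rw [hdetmap]; exact_mod_cast hd2
    · exact fun h => hN (map_injective hinj (by simpa using h))
    · rw [hdetmap, hdet, Int.cast_zero]
    · rw [← transpose_map, ← hmul]; exact h1.map _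
    · rw [← hmul]; exact h2.map _
    · rw [← transpose_map, ← hmul, ← hmul]; exact h3.map _
  have hNt : Nᵀ ≠ 0 := by simpa using hN
  have r1 : (W 1 * (red N)ᵀ).IsSymm := by rwa [transpose_red, isSymm_mul_red_iff hNt]
  have r2 : (W 2 * red N).IsSymm := by rwa [isSymm_mul_red_iff hN]
  have r3 : (W 2 * W 1 * (red N)ᵀ).IsSymm := by rwa [transpose_red, isSymm_mul_red_iff hNt]
  have hP := memP_red hdet
  refine ⟨red N, hP, fun h => hc1 (mul_comm_of_isSymm hP.2 h r1 r2 r3),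
    fun h => hc2 (mul_anticomm_of_isSymm hP.2 h r1 r2 r3), ?_⟩
  refine isSymm_mul_of_isFibP hFib (M := fun i => if i % 2 = 1 then (red N)ᵀ else red N)
    (fun i => ?_) r1 r2 r3
  rcases Nat.mod_two_eq_zero_or_one i with h | h
  · simp [h, Nat.add_mod]
  · simp [h, Nat.add_mod]
end

section
/- Let W₁, W₂ ∈ 𝒮 with W₁W₂ ≠ W₂W₁, and let (W_i)_{i≥1} be the Fibonacci sequence they generate, W_{i+2} = W_{i+1}W_i (ordinary matrix product; all terms lie in 𝒮 ⊆ 𝒫). Then (W_i)_{i≥1} is an admissible Fibonacci sequence in 𝒫. -/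
open Matrix

/-- The discriminant of the characteristic polynomial of a matrix of `Sset` is not a square. -/
theorem disc_ne_sq_of_mem_Sset {A : M2} (hA : A ∈ Sset) (s : ℤ) :
    (A 0 0 - A 1 1) ^ 2 + 4 * (A 0 1 * A 1 0) ≠ s ^ 2 := by
  obtain ⟨⟨h₁, h₂, h₃⟩, hdet⟩ := hA
  simp only [map_apply, max_le_iff, le_min_iff, Int.cast_le, Int.cast_nonneg_iff] at h₁ h₂ h₃
  rw [det_fin_two] at hdet
  obtain ⟨hba, hca⟩ := h₁
  obtain ⟨hdb, hdc⟩ := h₂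
  generalize A 0 0 = a at *
  generalize A 0 1 = b at *
  generalize A 1 0 = c at *
  generalize A 1 1 = d at *
  intro hs
  rw [← sq_abs s] at hs
  have hs₀ := abs_nonneg s
  generalize |s| = r at *
  rcases hdet with hdet | hdet
  · have hr : r ^ 2 = (a + d) ^ 2 - 4 := by linear_combination -hs - 4 * hdet
    have ht : 3 ≤ a + d := by
      by_contra! hlt
      have ha : a ≤ 2 := by omega
      have hb : b ≤ 2 := by omega
      have hc : c ≤ 2 := by omega
      have hd : d ≤ 2 := by omega
      have ha₀ : 0 ≤ a := by omega
      have hb₀ : 0 ≤ b := by omega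
      have hc₀ : 0 ≤ c := by omega
      interval_cases a <;> interval_cases d <;> first | omega | nlinarith
    rcases lt_or_ge r (a + d) with h | h <;> nlinarith
  · have hr : r ^ 2 = (a + d) ^ 2 + 4 := by linear_combination -hs - 4 * hdet
    have ht : 1 ≤ a + d := by
      by_contra! hlt
      have ha : a = 0 := by omega
      have hb : b = 0 := by omega
      subst ha hb
      simp at hdet
    have h₁ : a + d + 1 ≤ r := by
      by_contra! h
      nlinarith
    rcases h₁.eq_or_lt with h | h
    · rw [← h] at hr
      ring_nf at hr
      omega
    · nlinarith

/-- If the characteristic polynomial of `A` has no integer root, then a singular commutator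
with `A` vanishes. -/
theorem commutator_eq_zero_of_det_eq_zero {A B : M2}
    (hA : ∀ s : ℤ, (A 0 0 - A 1 1) ^ 2 + 4 * (A 0 1 * A 1 0) ≠ s ^ 2)
    (h : (A * B - B * A).det = 0) : A * B = B * A := by
  have hb : A 0 1 ≠ 0 := fun hb => hA (A 0 0 - A 1 1) (by rw [hb]; ring)
  rw [det_fin_two] at h
  simp only [Matrix.sub_apply, mul_apply, Fin.sum_univ_two] at h
  suffices h' : A 0 1 * B 1 0 - A 1 0 * B 0 1 = 0 ∧
      B 0 1 * (A 0 0 - A 1 1) - A 0 1 * (B 0 0 - B 1 1) = 0 ∧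
      A 1 0 * (B 0 0 - B 1 1) - B 1 0 * (A 0 0 - A 1 1) = 0 by
    obtain ⟨hp, hq, hr⟩ := h'
    ext i j
    fin_cases i <;> fin_cases j <;> simp [mul_apply, Fin.sum_univ_two] <;> linarith
  generalize A 0 0 = a at *
  generalize A 0 1 = b at *
  generalize A 1 0 = c at *
  generalize A 1 1 = d at *
  generalize B 0 0 = e at *
  generalize B 0 1 = f at *
  generalize B 1 0 = g at *
  generalize B 1 1 = k at *
  have hrel : (a - d) * (b * g - c * f) + b * (c * (e - k) - g * (a - d))
      + c * (f * (a - d) - b * (e - k)) = 0 := by ring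
  have hdet : (b * g - c * f) ^ 2
      + (f * (a - d) - b * (e - k)) * (c * (e - k) - g * (a - d)) = 0 := by
    linear_combination -h
  generalize b * g - c * f = p at *
  generalize f * (a - d) - b * (e - k) = q at *
  generalize c * (e - k) - g * (a - d) = r at *
  have hsq : (2 * b * p - (a - d) * q) ^ 2 = ((a - d) ^ 2 + 4 * (b * c)) * q ^ 2 := by
    linear_combination 4 * b ^ 2 * hdet - 4 * b * q * hrel
  have hq : q = 0 := by
    by_contra hq
    obtain ⟨s, hs⟩ : q ∣ 2 * b * p - (a - d) * q :=
      (Int.pow_dvd_pow_iff two_ne_zero).1 (hsq ▸ Dvd.intro_left _ rfl)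
    refine hA s (mul_right_cancel₀ (pow_ne_zero 2 hq) ?_)
    rw [← hsq, hs]
    ring
  subst hq
  have hp : p = 0 := by simpa using hdet
  subst hp
  exact ⟨rfl, rfl, by simpa [hb] using hrel⟩

theorem eq_content_smul_red (A : M2) : A = (content A : ℤ) • red A := by
  have h₀ : content A ∣ Nat.gcd (A 0 0).natAbs (A 0 1).natAbs := Nat.gcd_dvd_left _ _
  have h₁ : content A ∣ Nat.gcd (A 1 0).natAbs (A 1 1).natAbs := Nat.gcd_dvd_right _ _
  have key : ∀ i j, (content A : ℤ) ∣ A i j := by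
    intro i j
    rw [Int.natCast_dvd]
    fin_cases i <;> fin_cases j
    · exact h₀.trans (Nat.gcd_dvd_left _ _)
    · exact h₀.trans (Nat.gcd_dvd_right _ _)
    · exact h₁.trans (Nat.gcd_dvd_left _ _)
    · exact h₁.trans (Nat.gcd_dvd_right _ _)
  ext i j
  simp [red, Int.mul_ediv_cancel' (key i j)]

theorem isSymm_fin_two {R : Type*} {A : Matrix (Fin 2) (Fin 2) R} :
    A.IsSymm ↔ A 0 1 = A 1 0 := by
  constructor
  · exact fun h => h.apply 1 0
  · intro h
    ext i j
    fin_cases i <;> fin_cases j <;> simp [h]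

/-- The matrix witnessing admissibility for the pair `A`, `B`, up to content. -/
def admMatrix (A B : M2) : M2 :=
  (A.adjugate * B.adjugate * (A * B - B * A) * !![0, 1; -1, 0])ᵀ

theorem det_admMatrix (A B : M2) :
    (admMatrix A B).det = A.det * B.det * (A * B - B * A).det := by
  simp only [admMatrix, det_transpose, det_mul, det_adjugate, det_fin_two_of, Fintype.card_fin]
  ring

theorem isSymm_mul_admMatrix_transpose (A B : M2) : (A * (admMatrix A B)ᵀ).IsSymm := by
  rw [isSymm_fin_two]
  simp only [admMatrix, transpose_apply, mul_apply, Matrix.sub_apply, Fin.sum_univ_two,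
    adjugate_fin_two, of_apply, cons_val_zero, cons_val_one, cons_val', cons_val_fin_one]
  ring

theorem isSymm_mul_admMatrix (A B : M2) : (B * admMatrix A B).IsSymm := by
  rw [isSymm_fin_two]
  simp only [admMatrix, transpose_apply, mul_apply, Matrix.sub_apply, Fin.sum_univ_two,
    adjugate_fin_two, of_apply, cons_val_zero, cons_val_one, cons_val', cons_val_fin_one]
  ring

theorem isSymm_mul_mul_admMatrix_transpose (A B : M2) :
    (B * A * (admMatrix A B)ᵀ).IsSymm := by
  rw [isSymm_fin_two]
  simp only [admMatrix, transpose_apply, mul_apply, Matrix.sub_apply, Fin.sum_univ_two,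
    adjugate_fin_two, of_apply, cons_val_zero, cons_val_one, cons_val', cons_val_fin_one]
  ring

theorem isSymm_mul_of_isSymm_smul {A B : M2} {n : ℤ} (hn : n ≠ 0)
    (h : (A * n • B).IsSymm) : (A * B).IsSymm := by
  rw [isSymm_fin_two] at h ⊢
  rw [mul_smul_comm] at h
  simpa [hn] using h

/-- The symmetry conditions for the first three terms propagate to the whole sequence. -/
theorem isSymm_of_fib {W : ℕ → M2} {N : M2}
    (hFib : ∀ i, 1 ≤ i → W (i + 2) = W (i + 1) * W i)
    (h1 : (W 1 * Nᵀ).IsSymm) (h2 : (W 2 * N).IsSymm) (h3 : (W 3 * Nᵀ).IsSymm) :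
    ∀ i, 1 ≤ i → (W i * (if i % 2 = 1 then Nᵀ else N)).IsSymm := by
  set M : ℕ → M2 := fun i => if i % 2 = 1 then Nᵀ else N with hM
  have hM2 (i : ℕ) : M (i + 2) = M i := by simp [hM]
  have hMT (i : ℕ) : (M (i + 1))ᵀ = M i := by
    rcases Nat.mod_two_eq_zero_or_one i with h | h <;> simp [hM, Nat.add_mod, h]
  have key : ∀ k, (W (k + 1) * M (k + 1)).IsSymm ∧ (W (k + 2) * M (k + 2)).IsSymm ∧
      (W (k + 3) * M (k + 3)).IsSymm := by
    intro k
    induction k with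
    | zero => simpa [hM] using ⟨h1, h2, h3⟩
    | succ k ih =>
      obtain ⟨ha, hb, hc⟩ := ih
      refine ⟨hb, hc, ?_⟩
      have e : W (k + 4) * M (k + 4) = W (k + 2) * (W (k + 1) * M (k + 1)) * (W (k + 2))ᵀ := by
        have hb' : W (k + 2) * M (k + 2) = M (k + 1) * (W (k + 2))ᵀ := by
          rw [← hMT (k + 1), ← transpose_mul]
          exact hb.eq.symm
        rw [hM2 (k + 2), hFib (k + 2) (by omega), hFib (k + 1) (by omega), mul_assoc _ _ (M _),
          hb']
        simp only [mul_assoc]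
      change (W (k + 4) * M (k + 4)).IsSymm
      rw [e, IsSymm, transpose_mul, transpose_mul, ha.eq, transpose_transpose, ← mul_assoc]
  intro i hi
  obtain ⟨k, rfl⟩ := Nat.exists_eq_add_of_le' hi
  exact (key k).1

/-- Any Fibonacci sequence in 𝒮 generated by two non-commuting matrices of 𝒮 is
admissible. -/
theorem stmt12 (W : ℕ → M2) (h1 : W 1 ∈ Sset) (h2 : W 2 ∈ Sset)
    (hFib : ∀ i, 1 ≤ i → W (i + 2) = W (i + 1) * W i)
    (hnc : W 1 * W 2 ≠ W 2 * W 1) :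
    AdmissibleFib W := by
  have hdet : (admMatrix (W 1) (W 2)).det ≠ 0 := by
    rw [det_admMatrix]
    refine mul_ne_zero (mul_ne_zero ?_ ?_) fun h =>
      hnc (commutator_eq_zero_of_det_eq_zero (disc_ne_sq_of_mem_Sset h1) h)
    · rcases h1.2 with h | h <;> simp [h]
    · rcases h2.2 with h | h <;> simp [h]
  have hred := eq_content_smul_red (admMatrix (W 1) (W 2))
  have hP := memP_red hdet
  have hc : (content (admMatrix (W 1) (W 2)) : ℤ) ≠ 0 := by
    intro hc
    rw [hred, hc] at hdet
    simp at hdet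
  have hs1 := isSymm_mul_admMatrix_transpose (W 1) (W 2)
  have hs2 := isSymm_mul_admMatrix (W 1) (W 2)
  have hs3 := isSymm_mul_mul_admMatrix_transpose (W 1) (W 2)
  rw [← hFib 1 le_rfl] at hs3
  rw [hred, transpose_smul] at hs1 hs3
  rw [hred] at hs2
  replace hs1 := isSymm_mul_of_isSymm_smul hc hs1
  replace hs2 := isSymm_mul_of_isSymm_smul hc hs2
  replace hs3 := isSymm_mul_of_isSymm_smul hc hs3
  generalize red (admMatrix (W 1) (W 2)) = N at hP hs1 hs2 hs3
  refine ⟨N, hP, ?_, ?_, isSymm_of_fib hFib hs1 hs2 hs3⟩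
  · intro hN
    rw [← hN] at hs1 hs3
    have hW3 : W 3 = W 2 * W 1 := hFib 1 le_rfl
    have e1 : N * (W 1)ᵀ = W 1 * N := by
      have := hs1.eq
      rwa [transpose_mul, ← hN] at this
    have e2 : N * (W 2)ᵀ = W 2 * N := by
      have := hs2.eq
      rwa [transpose_mul, ← hN] at this
    have e3 : N * (W 1)ᵀ * (W 2)ᵀ = W 2 * W 1 * N := by
      have := hs3.eq
      rwa [hW3, transpose_mul, transpose_mul, ← hN, ← mul_assoc] at this
    rw [e1, mul_assoc, e2, ← mul_assoc] at e3
    have hz : (W 1 * W 2 - W 2 * W 1) * N = 0 := by rw [sub_mul, e3, sub_self]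
    refine hnc (sub_eq_zero.1 ?_)
    have hz' : N.det • (W 1 * W 2 - W 2 * W 1) = 0 := by
      rw [← mul_one (W 1 * W 2 - W 2 * W 1), ← mul_smul_comm, ← mul_adjugate, ← mul_assoc, hz,
        zero_mul]
    exact (smul_eq_zero.1 hz').resolve_left hP.2
  · intro hN
    have e00 := congrFun (congrFun hN 0) 0
    have e01 := congrFun (congrFun hN 0) 1
    have e11 := congrFun (congrFun hN 1) 1
    simp only [Matrix.neg_apply, transpose_apply] at e00 e01 e11
    have n00 : N 0 0 = 0 := by omega
    have n11 : N 1 1 = 0 := by omega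
    have hd := hP.2
    rw [det_fin_two, n00, n11, e01] at hd
    have n10 : N 1 0 ≠ 0 := fun h => hd (by rw [h]; ring)
    rw [isSymm_fin_two] at hs1
    simp only [mul_apply, Fin.sum_univ_two, transpose_apply, n00, n11, e01, mul_zero, zero_add,
      add_zero] at hs1
    have ht : W 1 0 0 + W 1 1 1 = 0 :=
      (mul_eq_zero.1 (by linear_combination hs1 :
        (W 1 0 0 + W 1 1 1) * N 1 0 = 0)).resolve_right n10
    rcases h1.2 with h | h
    · rw [det_fin_two] at h
      obtain ⟨⟨ha, hb, hc⟩, -⟩ := h1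
      simp only [map_apply, max_le_iff, le_min_iff, Int.cast_le, Int.cast_nonneg_iff] at ha hb hc
      have w00 : W 1 0 0 = 0 := by omega
      have w01 : W 1 0 1 = 0 := by omega
      simp [w00, w01] at h
    · rw [det_fin_two] at h
      refine disc_ne_sq_of_mem_Sset h1 2 ?_
      linear_combination (W 1 0 0 + W 1 1 1) * ht - 4 * h
end
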